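/- arXiv:1410.1910 — 6 statements merged into one kernel-verified Lean document; each statement's English description precedes it below -/
import Mathlib

section
/- For all n ≥ 2, the ideal Q_{n−1}, the contraction to S of the extension of P_{n−1} to S_Δ, is a prime ideal of S of height n. -/
open Matrix

/-- The generic `n × n` matrix whose entries are the variables `x i j` of the
polynomial ring `K[X]`. -/
noncomputable def genMat (K : Type*) [Field K] (n : ℕ) :
    Matrix (Fin n) (Fin n) (MvPolynomial (Fin n × Fin n) K) :=
  fun i j => MvPolynomial.X (i, j)

/-- `P_t`: the ideal generated by the principal `t`-minors of the generic matrix,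
i.e. the determinants of the submatrices whose rows and columns are both indexed by
a subset `s` of cardinality `t`. -/
noncomputable def prinMinorIdeal (K : Type*) [Field K] (n t : ℕ) :
    Ideal (MvPolynomial (Fin n × Fin n) K) :=
  Ideal.span {p | ∃ s : Finset (Fin n), s.card = t ∧
    p = ((genMat K n).submatrix (fun i : {x // x ∈ s} => (i : Fin n))
        (fun j : {x // x ∈ s} => (j : Fin n))).det}

/-- The height of an ideal: the infimum of the heights of the prime ideals
containing it (heights taken in the prime spectrum ordered by inclusion). -/
noncomputable def idealHeight {R : Type*} [CommRing R] (I : Ideal R) : ℕ∞ :=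
  ⨅ (p : PrimeSpectrum R) (_ : I ≤ p.asIdeal), Order.height p

/-- `Q_{n-1}`: the contraction to `S = K[X]` of the extension of `P_{n-1}` to the
localization `S_Δ = S[1/Δ]`, where `Δ = det X`. -/
noncomputable def Qideal (K : Type*) [Field K] (n : ℕ) :
    Ideal (MvPolynomial (Fin n × Fin n) K) :=
  Ideal.comap (algebraMap (MvPolynomial (Fin n × Fin n) K)
      (Localization.Away (genMat K n).det))
    (Ideal.map (algebraMap (MvPolynomial (Fin n × Fin n) K)
      (Localization.Away (genMat K n).det)) (prinMinorIdeal K n (n - 1)))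

namespace MvPolynomial

variable {σ K : Type*} [Field K]

open Classical in
/-- The substitution sending the variables indexed by `T` to zero. -/
noncomputable def killVars (K : Type*) [Field K] (T : Set σ) :
    MvPolynomial σ K →ₐ[K] MvPolynomial σ K :=
  aeval fun s => if s ∈ T then 0 else X s

lemma ker_killVars (T : Set σ) :
    RingHom.ker (killVars K T) = Ideal.span (X '' T) := by
  apply le_antisymm
  · intro p hp
    have h : (Ideal.Quotient.mkₐ K (Ideal.span (X '' T))).comp (killVars K T) =
        Ideal.Quotient.mkₐ K (Ideal.span (X '' T)) := by
      ext s
      by_cases hs : s ∈ T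
      · have : (Ideal.Quotient.mk (Ideal.span (X '' T))) (X s : MvPolynomial σ K) = 0 :=
          Ideal.Quotient.eq_zero_iff_mem.mpr (Ideal.subset_span ⟨s, hs, rfl⟩)
        simp [killVars, hs, this]
      · simp [killVars, hs]
    have hp' := DFunLike.congr_fun h p
    rw [AlgHom.comp_apply, RingHom.mem_ker.mp hp, map_zero] at hp'
    exact Ideal.Quotient.eq_zero_iff_mem.mp hp'.symm
  · rw [Ideal.span_le]
    rintro _ ⟨s, hs, rfl⟩
    simp [killVars, hs]

instance isPrime_span_X_image (T : Set σ) :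
    (Ideal.span (X '' T) : Ideal (MvPolynomial σ K)).IsPrime := by
  rw [← ker_killVars]
  exact RingHom.ker_isPrime _

lemma X_notMem_span_X_image {T : Set σ} {s : σ} (hs : s ∉ T) :
    (X s : MvPolynomial σ K) ∉ Ideal.span (X '' T) := by
  rw [← ker_killVars]
  simp [killVars, hs]

lemma height_span_X_image [Finite σ] (T : Finset σ) :
    (Ideal.span (X '' (T : Set σ)) : Ideal (MvPolynomial σ K)).height = T.card := by
  classical
  apply le_antisymm
  · have h := Ideal.height_le_card_of_mem_minimalPrimes_span_finset
      (R := MvPolynomial σ K) (s := T.image X) (p := Ideal.span (X '' (T : Set σ))) (by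
        rw [Finset.coe_image, Ideal.minimalPrimes_eq_subsingleton_self]
        rfl)
    exact h.trans (by exact_mod_cast Finset.card_image_le)
  · induction T using Finset.induction_on with
    | empty => simp
    | insert a T ha ih =>
      rw [Finset.card_insert_of_notMem ha, Nat.cast_add, Nat.cast_one]
      refine (add_le_add_left ih 1).trans (Ideal.height_add_one_le_of_lt_of_isPrime ?_)
      refine lt_of_le_of_ne (Ideal.span_mono (Set.image_mono (by simp))) fun h => ?_
      apply X_notMem_span_X_image (K := K) (Finset.mem_coe.not.mpr ha)
      rw [h]
      exact Ideal.subset_span ⟨a, by simp, rfl⟩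

end MvPolynomial

lemma Matrix.det_submatrix_erase_eq_adjugate {R : Type*} [CommRing R] {n : ℕ}
    (A : Matrix (Fin n) (Fin n) R) (i : Fin n) :
    (A.submatrix (fun j : {x // x ∈ Finset.univ.erase i} => (j : Fin n))
      (fun j : {x // x ∈ Finset.univ.erase i} => (j : Fin n))).det = A.adjugate i i := by
  cases n with
  | zero => exact i.elim0
  | succ n =>
    rw [adjugate_fin_succ_eq_det_submatrix, Even.neg_one_pow ⟨_, rfl⟩, one_mul,
      ← det_submatrix_equiv_self
        ((finSuccAboveEquiv i).trans (Equiv.subtypeEquivRight (by simp)))]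
    rfl

lemma prinMinorIdeal_pred_eq_span_adjugate (K : Type*) [Field K] (n : ℕ) (hn : 1 ≤ n) :
    prinMinorIdeal K n (n - 1) =
      Ideal.span (Set.range fun i => (genMat K n).adjugate i i) := by
  unfold prinMinorIdeal
  congr 1
  ext p
  constructor
  · rintro ⟨s, hs, rfl⟩
    have hc : sᶜ.card = 1 := by
      rw [Finset.card_compl, Fintype.card_fin]
      omega
    obtain ⟨i, hi⟩ := Finset.card_eq_one.mp hc
    obtain rfl : s = Finset.univ.erase i := by
      rw [← compl_compl s, hi]
      ext
      simp
    exact ⟨i, (det_submatrix_erase_eq_adjugate _ i).symm⟩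
  · rintro ⟨i, rfl⟩
    exact ⟨Finset.univ.erase i, by simp, (det_submatrix_erase_eq_adjugate _ i).symm⟩

section InverseAutomorphism

variable (K : Type*) [Field K] (n : ℕ)

/-- The coordinate ring of the general linear group. -/
abbrev GLRing : Type _ := Localization.Away (genMat K n).det

/-- The generic matrix over the coordinate ring of the general linear group. -/
noncomputable def locMat : Matrix (Fin n) (Fin n) (GLRing K n) :=
  (genMat K n).map (algebraMap _ _)

lemma det_locMat : (locMat K n).det = algebraMap _ (GLRing K n) (genMat K n).det :=
  (RingHom.map_det _ _).symm

lemma isUnit_det_locMat : IsUnit (locMat K n).det := by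
  rw [det_locMat]
  exact IsLocalization.Away.algebraMap_isUnit _

/-- The substitution of the inverse of the generic matrix for the generic matrix. -/
noncomputable def substInv :
    MvPolynomial (Fin n × Fin n) K →ₐ[K] GLRing K n :=
  MvPolynomial.aeval fun p => (locMat K n)⁻¹ p.1 p.2

lemma map_substInv_genMat : (genMat K n).map (substInv K n) = (locMat K n)⁻¹ := by
  ext i j
  simp [genMat, substInv]

lemma isUnit_substInv_det : IsUnit (substInv K n (genMat K n).det) := by
  have h : substInv K n (genMat K n).det = (locMat K n)⁻¹.det := by
    rw [AlgHom.map_det, AlgHom.mapMatrix_apply, map_substInv_genMat]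
  rw [h, isUnit_nonsing_inv_det_iff]
  exact isUnit_det_locMat K n

/-- The endomorphism of the coordinate ring of the general linear group induced by
matrix inversion. -/
noncomputable def invHom : GLRing K n →+* GLRing K n :=
  IsLocalization.Away.lift (genMat K n).det
    (g := (substInv K n : MvPolynomial (Fin n × Fin n) K →+* GLRing K n))
    (isUnit_substInv_det K n)

lemma invHom_algebraMap (p : MvPolynomial (Fin n × Fin n) K) :
    invHom K n (algebraMap _ _ p) = substInv K n p :=
  IsLocalization.Away.lift_eq _ _ _

lemma map_invHom_locMat : (locMat K n).map (invHom K n) = (locMat K n)⁻¹ := by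
  rw [← map_substInv_genMat]
  ext i j
  simp [locMat, invHom_algebraMap]

lemma map_invHom_inv_locMat : (locMat K n)⁻¹.map (invHom K n) = locMat K n := by
  have h : (locMat K n).map (invHom K n) * (locMat K n)⁻¹.map (invHom K n) = 1 := by
    rw [← Matrix.map_mul, mul_nonsing_inv _ (isUnit_det_locMat K n)]
    exact Matrix.map_one _ (map_zero _) (map_one _)
  rw [map_invHom_locMat] at h
  rw [← inv_eq_right_inv h, nonsing_inv_nonsing_inv _ (isUnit_det_locMat K n)]

lemma invHom_comp_invHom : (invHom K n).comp (invHom K n) = RingHom.id _ := by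
  apply IsLocalization.ringHom_ext (Submonoid.powers (genMat K n).det)
  apply MvPolynomial.ringHom_ext
  · intro r
    have h : substInv K n (MvPolynomial.C r) =
        algebraMap (MvPolynomial (Fin n × Fin n) K) (GLRing K n) (MvPolynomial.C r) := by
      rw [← MvPolynomial.algebraMap_eq, AlgHom.commutes, ← IsScalarTower.algebraMap_apply]
    simp [invHom_algebraMap, h]
  · rintro ⟨i, j⟩
    have h : substInv K n (MvPolynomial.X (i, j)) = (locMat K n)⁻¹ i j := by simp [substInv]
    have h' : invHom K n ((locMat K n)⁻¹ i j) =
        algebraMap (MvPolynomial (Fin n × Fin n) K) (GLRing K n) (MvPolynomial.X (i, j)) :=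
      congrFun₂ (map_invHom_inv_locMat K n) i j
    simpa [invHom_algebraMap, h] using h'

/-- The involution of the coordinate ring of the general linear group induced by
matrix inversion. -/
noncomputable def invEquiv : GLRing K n ≃+* GLRing K n :=
  RingEquiv.ofRingHom (invHom K n) (invHom K n) (invHom_comp_invHom K n) (invHom_comp_invHom K n)

/-- The ideal generated by the diagonal entries of the generic matrix. -/
noncomputable def diagIdeal : Ideal (MvPolynomial (Fin n × Fin n) K) :=
  Ideal.span (MvPolynomial.X '' (Finset.univ.image fun i : Fin n => (i, i) :
    Finset (Fin n × Fin n)))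

instance : (diagIdeal K n).IsPrime := MvPolynomial.isPrime_span_X_image _

lemma height_diagIdeal : (diagIdeal K n).height = n := by
  rw [diagIdeal, MvPolynomial.height_span_X_image, Finset.card_image_of_injective]
  · simp
  · exact fun i j h => congrArg Prod.fst h

lemma det_genMat_notMem_diagIdeal (hn : 2 ≤ n) : (genMat K n).det ∉ diagIdeal K n := by
  obtain ⟨m, rfl⟩ := Nat.exists_eq_add_of_le' hn
  let e := finRotate (m + 2)
  let ev : MvPolynomial (Fin (m + 2) × Fin (m + 2)) K →ₐ[K] K :=
    MvPolynomial.aeval fun p => e.permMatrix K p.1 p.2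
  have hle : diagIdeal K (m + 2) ≤ RingHom.ker ev := by
    rw [diagIdeal, Ideal.span_le]
    rintro _ ⟨p, hp, rfl⟩
    obtain ⟨i, rfl⟩ : ∃ i, (i, i) = p := by simpa using hp
    simp [ev, e, Equiv.Perm.permMatrix, PEquiv.toMatrix_apply]
  intro h
  have h0 : ev (genMat K (m + 2)).det = 0 := hle h
  have h1 : (genMat K (m + 2)).map ev = e.permMatrix K := by
    ext i j
    simp [genMat, ev]
  rw [AlgHom.map_det, AlgHom.mapMatrix_apply, h1, det_permutation] at h0
  rcases Int.units_eq_one_or (Equiv.Perm.sign e) with h | h <;> simp [h] at h0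

lemma map_invEquiv_map_diagIdeal (hn : 1 ≤ n) :
    ((diagIdeal K n).map (algebraMap _ (GLRing K n))).map (invEquiv K n) =
      (prinMinorIdeal K n (n - 1)).map (algebraMap _ (GLRing K n)) := by
  have key (i : Fin n) : (locMat K n).det *
      invEquiv K n (algebraMap _ _ (genMat K n i i)) =
        algebraMap _ (GLRing K n) ((genMat K n).adjugate i i) := by
    have h1 : invEquiv K n (algebraMap _ _ (genMat K n i i)) = (locMat K n)⁻¹ i i :=
      congrFun₂ (map_invHom_locMat K n) i i
    have h2 : algebraMap _ (GLRing K n) ((genMat K n).adjugate i i) =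
        (locMat K n).adjugate i i :=
      congrFun₂ (RingHom.map_adjugate (algebraMap _ (GLRing K n)) (genMat K n)) i i
    rw [h1, h2, inv_def, Matrix.smul_apply, smul_eq_mul, ← mul_assoc,
      Ring.mul_inverse_cancel _ (isUnit_det_locMat K n), one_mul]
  rw [prinMinorIdeal_pred_eq_span_adjugate K n hn, diagIdeal, Ideal.map_span, Ideal.map_span,
    Ideal.map_span]
  apply le_antisymm <;> rw [Ideal.span_le]
  · rintro _ ⟨_, ⟨_, ⟨p, hp, rfl⟩, rfl⟩, rfl⟩
    obtain ⟨i, rfl⟩ : ∃ i, (i, i) = p := by simpa using hp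
    rw [SetLike.mem_coe, ← Ideal.unit_mul_mem_iff_mem _ (isUnit_det_locMat K n)]
    refine (key i).symm ▸ ?_
    exact Ideal.subset_span ⟨_, ⟨i, rfl⟩, rfl⟩
  · rintro _ ⟨_, ⟨i, rfl⟩, rfl⟩
    simp only [← key]
    exact Ideal.mul_mem_left _ _
      (Ideal.subset_span ⟨_, ⟨_, ⟨(i, i), by simp, rfl⟩, rfl⟩, rfl⟩)

end InverseAutomorphism

lemma idealHeight_eq_height {R : Type*} [CommRing R] (I : Ideal R) [hI : I.IsPrime] :
    idealHeight I = I.height := by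
  refine le_antisymm ?_ (le_iInf₂ fun p hp => ?_)
  · exact (iInf₂_le (⟨I, hI⟩ : PrimeSpectrum R) le_rfl).trans (PrimeSpectrum.height_eq_orderHeight ⟨I, hI⟩).ge
  · rw [← PrimeSpectrum.height_eq_orderHeight]
    exact Ideal.height_mono hp

/-- For all `n ≥ 2`, the ideal `Q_{n-1}` (the contraction to `S` of the extension
of `P_{n-1}` to `S_Δ`) is a prime ideal of `S` of height `n`. -/
theorem Qideal_isPrime_height (K : Type*) [Field K] [IsAlgClosed K]
    (n : ℕ) (hn : 2 ≤ n) :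
    (Qideal K n).IsPrime ∧ idealHeight (Qideal K n) = (n : ℕ∞) := by
  have hd : Disjoint (Submonoid.powers (genMat K n).det : Set (MvPolynomial (Fin n × Fin n) K))
      (diagIdeal K n) := by
    rw [Set.disjoint_left]
    rintro _ ⟨k, rfl⟩ h
    exact det_genMat_notMem_diagIdeal K n hn (Ideal.IsPrime.mem_of_pow_mem inferInstance k h)
  have hp : ((diagIdeal K n).map (algebraMap _ (GLRing K n))).IsPrime :=
    IsLocalization.isPrime_of_isPrime_disjoint _ _ _ inferInstance hd
  have hP := map_invEquiv_map_diagIdeal K n (by omega)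
  have hprime : ((prinMinorIdeal K n (n - 1)).map (algebraMap _ (GLRing K n))).IsPrime := by
    rw [← hP]
    exact Ideal.map_isPrime_of_equiv _
  have hQ : (Qideal K n).IsPrime := Ideal.comap_isPrime _ _
  refine ⟨hQ, ?_⟩
  rw [idealHeight_eq_height, Qideal]
  refine (IsLocalization.height_under (Submonoid.powers (genMat K n).det) _).trans ?_
  rw [← hP, RingEquiv.height_map,
    IsLocalization.height_map_of_disjoint (Submonoid.powers (genMat K n).det) _ hd,
    height_diagIdeal]
end

section
/- For all n ≥ 4, the prime ideals I_{n−1} and Q_{n−1} are incomparable: neither I_{n−1} ⊆ Q_{n−1} nor Q_{n−1} ⊆ I_{n−1} holds. -/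
open Matrix

/-- `I_t`: the determinantal ideal generated by all `t × t` minors of the generic
matrix. -/
noncomputable def detIdeal (K : Type*) [Field K] (n t : ℕ) :
    Ideal (MvPolynomial (Fin n × Fin n) K) :=
  Ideal.span {p | ∃ (I J : Finset (Fin n)) (hI : I.card = t) (hJ : J.card = t),
    p = (Matrix.of fun a b : Fin t =>
        genMat K n (I.orderIsoOfFin hI a) (J.orderIsoOfFin hJ b)).det}

namespace Matrix

variable {ι R : Type*} [Fintype ι] [DecidableEq ι] [CommRing R]

/-- The determinant of `A` after replacing column `i` by the basis vector `e_j` and then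
column `k` by the basis vector `e_l`: up to sign, the minor of `A` with the rows `j, l` and the
columns `i, k` deleted. -/
def secondCofactor (A : Matrix ι ι R) (i j k l : ι) : R :=
  ((A.updateCol i (Pi.single j 1)).updateCol k (Pi.single l 1)).det

theorem map_secondCofactor {R' : Type*} [CommRing R'] (φ : R →+* R') (A : Matrix ι ι R)
    (i j k l : ι) : φ (A.secondCofactor i j k l) = (A.map φ).secondCofactor i j k l := by
  rw [secondCofactor, secondCofactor, φ.map_det]
  congr 1
  ext a b
  simp only [RingHom.mapMatrix_apply, map_apply, updateCol_apply, Pi.single_apply]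
  split_ifs <;> simp

theorem secondCofactor_submatrix_equiv {κ : Type*} [Fintype κ] [DecidableEq κ]
    (A : Matrix ι ι R) (e : κ ≃ ι) (i j k l : κ) :
    (A.submatrix e e).secondCofactor i j k l = A.secondCofactor (e i) (e j) (e k) (e l) := by
  rw [secondCofactor, secondCofactor, ← det_submatrix_equiv_self e]
  congr 1
  ext a b
  simp [updateCol_apply, Pi.single_apply]

theorem secondCofactor_fromBlocks_one {κ : Type*} [Fintype κ] [DecidableEq κ]
    (A : Matrix ι ι R) (i j k l : ι) :
    (fromBlocks (1 : Matrix κ κ R) 0 0 A).secondCofactor (.inr i) (.inr j) (.inr k) (.inr l) =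
      A.secondCofactor i j k l := by
  have h : ((fromBlocks (1 : Matrix κ κ R) 0 0 A).updateCol (.inr i)
      (Pi.single (.inr j) 1)).updateCol (.inr k) (Pi.single (.inr l) 1) =
      fromBlocks 1 0 0 ((A.updateCol i (Pi.single j 1)).updateCol k (Pi.single l 1)) := by
    ext (a | a) (b | b) <;> simp [updateCol_apply, Pi.single_apply]
  rw [secondCofactor, secondCofactor, h, det_fromBlocks_zero₂₁, det_one, one_mul]

/-- Jacobi's complementary minor formula for `2 × 2` minors of the inverse. -/
theorem secondCofactor_eq_det_mul (A : Matrix ι ι R) (hA : IsUnit A.det) {i k : ι} (hik : i ≠ k)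
    (j l : ι) : A.secondCofactor i j k l = A.det * (A⁻¹ i j * A⁻¹ k l - A⁻¹ i l * A⁻¹ k j) := by
  have hAA : A * A⁻¹ = 1 := mul_nonsing_inv A hA
  let U : Matrix ι (Fin 2) R := of fun a b => A⁻¹ a (![j, l] b) - (1 : Matrix ι ι R) a (![i, k] b)
  let V : Matrix (Fin 2) ι R := of fun a b => (1 : Matrix ι ι R) (![i, k] a) b
  have h : (A.updateCol i (Pi.single j 1)).updateCol k (Pi.single l 1) = A * (1 + U * V) := by
    have hU : A * U = of fun a b => (1 : Matrix ι ι R) a (![j, l] b) - A a (![i, k] b) := by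
      ext a b
      have h1 : ∀ c, ∑ x, A a x * A⁻¹ x c = (1 : Matrix ι ι R) a c := fun c => by
        rw [← hAA, mul_apply]
      simp only [U, mul_apply, of_apply, mul_sub, Finset.sum_sub_distrib, h1]
      simp [one_apply]
    rw [mul_add, mul_one, ← Matrix.mul_assoc, hU]
    ext a b
    by_cases hb : b = k
    · subst hb
      simp [mul_apply, V, one_apply, Pi.single_apply, hik]
    · by_cases hb' : b = i
      · subst hb'
        rw [updateCol_ne hb]
        simp [mul_apply, V, one_apply, Pi.single_apply, hik.symm]
        congr
      · simp [mul_apply, V, one_apply, hb, hb', Ne.symm hb, Ne.symm hb']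
  have hV : 1 + V * U = !![A⁻¹ i j, A⁻¹ i l; A⁻¹ k j, A⁻¹ k l] := by
    ext a b
    fin_cases a <;> fin_cases b <;> simp [mul_apply, U, V, one_apply, hik.symm, eq_comm (a := i)]
  rw [secondCofactor, h, det_mul, det_one_add_mul_comm, hV, det_fin_two_of]

theorem det_submatrix_mul_eq_zero {m κ t : Type*} {K : Type*} [Field K] [Fintype κ] [Fintype t]
    [DecidableEq t] (U : Matrix m κ K) (V : Matrix κ m K) (r c : t → m)
    (h : Fintype.card κ < Fintype.card t) : ((U * V).submatrix r c).det = 0 := by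
  by_contra h0
  have h1 := rank_of_isUnit _ ((isUnit_iff_isUnit_det _).2 (isUnit_iff_ne_zero.2 h0))
  rw [show (U * V).submatrix r c = U.submatrix r id * V.submatrix id c from
    submatrix_mul U V r id c Function.bijective_id] at h1
  have h2 := (rank_mul_le_left (U.submatrix r id) (V.submatrix id c)).trans (rank_le_card_width _)
  omega

end Matrix

section

variable {K : Type*} [Field K]

/-- Evaluation of polynomials in the entries of the generic matrix at a given matrix. -/
noncomputable def evalMat {n : ℕ} (A : Matrix (Fin n) (Fin n) K) :
    MvPolynomial (Fin n × Fin n) K →+* K :=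
  MvPolynomial.eval fun p => A p.1 p.2

theorem genMat_map_evalMat {n : ℕ} (A : Matrix (Fin n) (Fin n) K) :
    (genMat K n).map (evalMat A) = A := by
  ext i j
  simp [genMat, evalMat]

theorem evalMat_det_submatrix {n : ℕ} {t : Type*} [Fintype t] [DecidableEq t]
    (A : Matrix (Fin n) (Fin n) K) (r c : t → Fin n) :
    evalMat A ((genMat K n).submatrix r c).det = (A.submatrix r c).det := by
  rw [RingHom.map_det, RingHom.mapMatrix_apply, ← submatrix_map, genMat_map_evalMat]

theorem adjugate_genMat_diag_mem (n : ℕ) (i : Fin (n + 1)) :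
    (genMat K (n + 1)).adjugate i i ∈ prinMinorIdeal K (n + 1) n := by
  rw [adjugate_fin_succ_eq_det_submatrix]
  refine Ideal.mul_mem_left _ _ (Ideal.subset_span ⟨{i}ᶜ, by simp [Finset.card_compl], ?_⟩)
  let e : Fin n ≃ {x // x ∈ ({i}ᶜ : Finset (Fin (n + 1)))} :=
    (finSuccAboveEquiv i).trans (Equiv.subtypeEquivRight fun x => by simp)
  rw [← det_submatrix_equiv_self e]
  rfl

theorem det_genMat_mem_detIdeal (n : ℕ) :
    (genMat K (n + 1)).det ∈ detIdeal K (n + 1) n := by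
  rw [det_succ_row_zero]
  refine Ideal.sum_mem _ fun j _ => Ideal.mul_mem_left _ _ (Ideal.subset_span
    ⟨{0}ᶜ, {j}ᶜ, by simp [Finset.card_compl], by simp [Finset.card_compl], ?_⟩)
  congr 1
  ext a b
  have h (i : Fin (n + 1)) (hi : ({i}ᶜ : Finset (Fin (n + 1))).card = n) (a : Fin n) :
      (({i}ᶜ : Finset (Fin (n + 1))).orderIsoOfFin hi a : Fin (n + 1)) = i.succAbove a :=
    (congrFun (Finset.orderEmbOfFin_unique hi (fun x => by simp)
      (Fin.strictMono_succAbove i)) a).symm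
  simp only [submatrix_apply, of_apply, h, Fin.zero_succAbove]

/-- `Q` vanishes at every invertible matrix at which the principal minors vanish. -/
theorem evalMat_eq_zero_of_mem_Qideal {n : ℕ} {A : Matrix (Fin n) (Fin n) K} (hA : A.det ≠ 0)
    (hP : ∀ s : Finset (Fin n), s.card = n - 1 →
      (A.submatrix (fun i : {x // x ∈ s} => (i : Fin n)) fun j : {x // x ∈ s} => (j : Fin n)).det
        = 0)
    {p : MvPolynomial (Fin n × Fin n) K} (hp : p ∈ Qideal K n) : evalMat A p = 0 := by
  have hu : IsUnit (evalMat A (genMat K n).det) := by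
    rw [RingHom.map_det, RingHom.mapMatrix_apply, genMat_map_evalMat]
    exact isUnit_iff_ne_zero.2 hA
  let φ : Localization.Away (genMat K n).det →+* K :=
    IsLocalization.Away.lift (genMat K n).det hu
  have hφ (q) : φ (algebraMap _ _ q) = evalMat A q := IsLocalization.Away.lift_eq _ hu q
  have hle : Ideal.map (algebraMap _ (Localization.Away (genMat K n).det))
      (prinMinorIdeal K n (n - 1)) ≤ RingHom.ker φ := by
    rw [Ideal.map_le_iff_le_comap, prinMinorIdeal, Ideal.span_le]
    rintro _ ⟨s, hs, rfl⟩
    simp only [SetLike.mem_coe, Ideal.mem_comap, RingHom.mem_ker, hφ, evalMat_det_submatrix, hP s hs]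
  rw [← hφ]
  exact hle hp

theorem not_detIdeal_le_Qideal (n : ℕ) :
    ¬ detIdeal K (n + 2) (n + 1) ≤ Qideal K (n + 2) := by
  intro hle
  let σ : Equiv.Perm (Fin (n + 2)) := finRotate (n + 2)
  have hdet : (σ.permMatrix K).det ≠ 0 := by
    rw [det_permutation]
    rcases Int.units_eq_one_or (Equiv.Perm.sign σ) with h | h <;> simp [h]
  have h := evalMat_eq_zero_of_mem_Qideal hdet (fun s hs => ?_) (hle (det_genMat_mem_detIdeal _))
  · rw [RingHom.map_det, RingHom.mapMatrix_apply, genMat_map_evalMat] at h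
    exact hdet h
  · obtain ⟨a, ha⟩ : ∃ a, sᶜ = {a} := Finset.card_eq_one.1 (by
      rw [Finset.card_compl, hs, Fintype.card_fin]; omega)
    have hmem (x) : x ∈ s ↔ x ≠ a := by
      rw [← not_iff_not, ← Finset.mem_compl, ha]; simp
    have hfix (x) : σ x ≠ x := by
      simp [σ]
    have hb : σ.symm a ∈ s := by
      rw [hmem]
      intro h
      exact hfix a (by conv_lhs => rw [← h, Equiv.apply_symm_apply])
    refine det_eq_zero_of_row_eq_zero ⟨σ.symm a, hb⟩ fun j => ?_
    have hj := (hmem _).1 j.2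
    simp [Equiv.Perm.permMatrix, PEquiv.toMatrix_apply, Equiv.toPEquiv_apply, hj.symm]

/-- A polynomial which is a multiple of `Δ²` times
`b_{wx} b_{xy} · b_{yz} b_{zw} - b_{xy} b_{yz} · b_{zw} b_{wx} = 0` modulo the diagonal entries of
the inverse `b` of `A`. -/
def cyclePoly {ι R : Type*} [Fintype ι] [DecidableEq ι] [CommRing R] (A : Matrix ι ι R)
    (w x y z : ι) : R :=
  A.secondCofactor w x x y * A.secondCofactor y z z w -
    A.secondCofactor x y y z * A.secondCofactor z w w x

theorem cyclePoly_mem_Qideal {n : ℕ} {w x y z : Fin (n + 1)} (hwx : w ≠ x) (hxy : x ≠ y)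
    (hyz : y ≠ z) (hzw : z ≠ w) :
    cyclePoly (genMat K (n + 1)) w x y z ∈ Qideal K (n + 1) := by
  let L := Localization.Away (genMat K (n + 1)).det
  let φ : MvPolynomial (Fin (n + 1) × Fin (n + 1)) K →+* L := algebraMap _ L
  let A : Matrix (Fin (n + 1)) (Fin (n + 1)) L := (genMat K (n + 1)).map φ
  let J : Ideal L := (prinMinorIdeal K (n + 1) n).map φ
  have hA : IsUnit A.det := by
    rw [show A = φ.mapMatrix (genMat K (n + 1)) from rfl, ← RingHom.map_det]
    exact IsLocalization.Away.algebraMap_isUnit _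
  have hd (i) : A⁻¹ i i ∈ J := by
    rw [inv_def, Matrix.smul_apply, smul_eq_mul, show A = φ.mapMatrix (genMat K (n + 1)) from rfl,
      ← RingHom.map_adjugate]
    exact J.mul_mem_left _ (Ideal.mem_map_of_mem φ (adjugate_genMat_diag_mem n i))
  change φ _ ∈ J
  simp only [cyclePoly, map_sub, map_mul, map_secondCofactor]
  change A.secondCofactor w x x y * A.secondCofactor y z z w -
    A.secondCofactor x y y z * A.secondCofactor z w w x ∈ J
  simp only [secondCofactor_eq_det_mul A hA hwx, secondCofactor_eq_det_mul A hA hxy,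
    secondCofactor_eq_det_mul A hA hyz, secondCofactor_eq_det_mul A hA hzw]
  have hq (i) : Ideal.Quotient.mk J (A⁻¹ i i) = 0 := Ideal.Quotient.eq_zero_iff_mem.2 (hd i)
  rw [← Ideal.Quotient.eq_zero_iff_mem]
  simp only [map_sub, map_mul, hq]
  ring

/-- A polynomial of `I_t` vanishes at every matrix of rank less than `t`. -/
theorem evalMat_eq_zero_of_mem_detIdeal {n t : ℕ} {κ : Type*} [Fintype κ]
    (U : Matrix (Fin n) κ K) (V : Matrix κ (Fin n) K) (h : Fintype.card κ < t)
    {p : MvPolynomial (Fin n × Fin n) K} (hp : p ∈ detIdeal K n t) : evalMat (U * V) p = 0 := by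
  suffices hle : detIdeal K n t ≤ RingHom.ker (evalMat (U * V)) from hle hp
  rw [detIdeal, Ideal.span_le]
  rintro _ ⟨I, J, hI, hJ, rfl⟩
  exact (evalMat_det_submatrix _ (fun a => (I.orderIsoOfFin hI a : Fin n))
    fun b => (J.orderIsoOfFin hJ b : Fin n)).trans
      (det_submatrix_mul_eq_zero U V _ _ (by simpa using h))

theorem cyclePoly_four :
    cyclePoly ((!![1, 0; 1, 0; 0, 1; 0, 1] : Matrix (Fin 4) (Fin 2) K) *
      (!![1, 0, 1, 0; 0, 1, 0, 1] : Matrix (Fin 2) (Fin 4) K)) 0 1 2 3 ≠ 0 := by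
  have h : (!![1, 0; 1, 0; 0, 1; 0, 1] : Matrix (Fin 4) (Fin 2) K) *
      (!![1, 0, 1, 0; 0, 1, 0, 1] : Matrix (Fin 2) (Fin 4) K) =
      !![1, 0, 1, 0; 1, 0, 1, 0; 0, 1, 0, 1; 0, 1, 0, 1] := by
    ext i j
    fin_cases i <;> fin_cases j <;> simp [mul_apply]
  rw [h]
  simp [cyclePoly, secondCofactor, det_succ_row_zero, Fin.sum_univ_succ, updateCol_apply,
    Fin.succAbove]

theorem not_Qideal_le_detIdeal (m : ℕ) :
    ¬ Qideal K (m + 4) ≤ detIdeal K (m + 4) (m + 3) := by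
  intro hle
  let e : Fin m ⊕ Fin 4 ≃ Fin (m + 4) := finSumFinEquiv
  let U₀ : Matrix (Fin 4) (Fin 2) K := !![1, 0; 1, 0; 0, 1; 0, 1]
  let V₀ : Matrix (Fin 2) (Fin 4) K := !![1, 0, 1, 0; 0, 1, 0, 1]
  let U : Matrix (Fin m ⊕ Fin 4) (Fin m ⊕ Fin 2) K := fromBlocks 1 0 0 U₀
  let V : Matrix (Fin m ⊕ Fin 2) (Fin m ⊕ Fin 4) K := fromBlocks 1 0 0 V₀
  have hne {a b : Fin 4} (h : a ≠ b) : e (.inr a) ≠ e (.inr b) := by simpa using h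
  have h0 := evalMat_eq_zero_of_mem_detIdeal (U.submatrix e.symm id) (V.submatrix id e.symm)
    (by simp) (hle (cyclePoly_mem_Qideal (hne (a := 0) (b := 1) (by decide))
      (hne (b := 2) (by decide)) (hne (b := 3) (by decide)) (hne (by decide))))
  have hUV : U.submatrix e.symm id * V.submatrix id e.symm =
      (fromBlocks 1 0 0 (U₀ * V₀)).submatrix e.symm e.symm := by
    rw [← submatrix_mul U V e.symm id e.symm Function.bijective_id, fromBlocks_multiply]
    simp
  simp only [cyclePoly, map_sub, map_mul, map_secondCofactor, genMat_map_evalMat, hUV,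
    secondCofactor_submatrix_equiv, Equiv.symm_apply_apply, secondCofactor_fromBlocks_one] at h0
  exact cyclePoly_four h0

end

/-- For all `n ≥ 4`, the prime ideals `I_{n-1}` and `Q_{n-1}` are incomparable:
neither contains the other. -/
theorem detIdeal_Qideal_incomparable (K : Type*) [Field K] [IsAlgClosed K]
    (n : ℕ) (hn : 4 ≤ n) :
    ¬ detIdeal K n (n - 1) ≤ Qideal K n ∧ ¬ Qideal K n ≤ detIdeal K n (n - 1) := by
  obtain ⟨m, rfl⟩ := Nat.exists_eq_add_of_le' hn
  exact ⟨not_detIdeal_le_Qideal (m + 2), not_Qideal_le_detIdeal m⟩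
end

section
/- For every positive integer n with n ≠ 3 and every t with 1 ≤ t ≤ n, the height of the ideal P_t generated by the principal t-minors of the generic n×n matrix satisfies ht(P_t) ≤ C(n+1,2) − C(t+2,2) + 4, where C(a,2) = a(a−1)/2 denotes a binomial coefficient. -/
open Matrix

namespace Matrix

variable {m o s R : Type*} [CommRing R] [Fintype o] [DecidableEq o]

/-- The matrix `δ A - A₁ adj(B) A₂`, where `B` is the principal submatrix of `A` indexed by `f`,
`δ = det B`, and `A₁`, `A₂` are the columns and the rows of `A` indexed by `f`. When `δ` is
invertible this is `δ` times the Schur complement of `B`, extended by zero. -/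
def scaledSchur (A : Matrix m m R) (f : o → m) : Matrix m m R :=
  (A.submatrix f f).det • A -
    A.submatrix id f * ((A.submatrix f f).adjugate * A.submatrix f id)

theorem scaledSchur_map {S : Type*} [CommRing S] (φ : R →+* S) (A : Matrix m m R) (f : o → m)
    (i j : m) : φ (A.scaledSchur f i j) = (A.map φ).scaledSchur f i j := by
  have hadj (a b : o) : φ ((A.submatrix f f).adjugate a b) =
      ((A.map φ).submatrix f f).adjugate a b :=
    congr_fun₂ (φ.map_adjugate (A.submatrix f f)) a b
  have hdet : φ (A.submatrix f f).det = ((A.map φ).submatrix f f).det :=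
    φ.map_det (A.submatrix f f)
  simp [scaledSchur, mul_apply, hadj, hdet]

theorem scaledSchur_apply_left (A : Matrix m m R) (f : o → m) (a : o) (j : m) :
    A.scaledSchur f (f a) j = 0 := by
  have h : A.submatrix f f * ((A.submatrix f f).adjugate * A.submatrix f id) =
      (A.submatrix f f).det • A.submatrix f id := by
    rw [← Matrix.mul_assoc, mul_adjugate, smul_mul, Matrix.one_mul]
  have h' := congr_fun₂ h a j
  rw [scaledSchur, sub_apply, sub_eq_zero]
  exact h'.symm

theorem scaledSchur_apply_right (A : Matrix m m R) (f : o → m) (i : m) (b : o) :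
    A.scaledSchur f i (f b) = 0 := by
  have h : A.submatrix id f * ((A.submatrix f f).adjugate * A.submatrix f f) =
      (A.submatrix f f).det • A.submatrix id f := by
    rw [adjugate_mul, Matrix.mul_smul, Matrix.mul_one]
  have h' := congr_fun₂ h i b
  rw [scaledSchur, sub_apply, sub_eq_zero]
  exact h'.symm

theorem det_submatrix_eq_zero_of_scaledSchur [IsDomain R] [Fintype s] [DecidableEq s]
    (A : Matrix m m R) (f : o → m) (hf : (A.submatrix f f).det ≠ 0) (e : s → m)
    (he : ∀ i j, A.scaledSchur f (e i) (e j) = 0) (hc : Fintype.card o < Fintype.card s) :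
    (A.submatrix e e).det = 0 := by
  by_contra hne
  have hfac : (A.submatrix f f).det • A.submatrix e e =
      A.submatrix e f * ((A.submatrix f f).adjugate * A.submatrix f e) := by
    ext i j
    exact sub_eq_zero.1 (he i j)
  have hrank := rank_of_det_ne_zero (A := (A.submatrix f f).det • A.submatrix e e)
    (by rw [det_smul]; exact mul_ne_zero (pow_ne_zero _ hf) hne)
  rw [hfac] at hrank
  have h₁ := rank_mul_le_left (A.submatrix e f)
    ((A.submatrix f f).adjugate * A.submatrix f e)
  have h₂ := rank_le_card_width (A.submatrix e f)
  omega

end Matrix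

/-- The number of pairs `j ≤ i` with `t + 1 ≤ i < n`. -/
theorem card_lower_pairs_le (n t : ℕ) :
    (Finset.univ.filter fun p : Fin n × Fin n => t + 1 ≤ p.1.val ∧ p.2 ≤ p.1).card ≤
      Nat.choose (n + 1) 2 - Nat.choose (t + 2) 2 := by
  have hsum : ∑ i ∈ Finset.Ico (t + 1) n, (i + 1) =
      Nat.choose (n + 1) 2 - Nat.choose (t + 2) 2 := by
    rcases le_total n (t + 1) with h | h
    · rw [Finset.Ico_eq_empty_of_le h, Finset.sum_empty, eq_comm, Nat.sub_eq_zero_iff_le]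
      exact Nat.choose_le_choose 2 (by omega)
    · refine eq_tsub_of_add_eq ?_
      induction n, h using Nat.le_induction with
      | base => simp
      | succ k hk ih =>
        rw [Finset.sum_Ico_succ_top hk, Nat.choose_succ_succ' (k + 1) 1, Nat.choose_one_right, one_add_one_eq_two]
        omega
  rw [← hsum, ← Finset.sum_congr rfl fun i _ => Finset.card_range (i + 1), ← Finset.card_sigma]
  refine Finset.card_le_card_of_injOn (fun p => ⟨p.1.val, p.2.val⟩) ?_ ?_
  · rintro ⟨i, j⟩ h
    simp only [Finset.coe_filter, Finset.mem_univ, true_and, Set.mem_ofPred_eq] at h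
    simp only [Finset.coe_sigma, Set.mem_sigma_iff, Finset.mem_coe, Finset.mem_Ico,
      Finset.mem_range]
    have := i.isLt
    have := Fin.le_def.1 h.2
    omega
  · rintro ⟨i, j⟩ _ ⟨i', j'⟩ _ h
    simpa [Fin.ext_iff] using h

/-- At most four pairs have both coordinates in `{r, r + 1}`. -/
theorem card_corner_pairs_le (n r : ℕ) :
    (Finset.univ.filter fun p : Fin n × Fin n =>
      (r ≤ p.1.val ∧ p.1.val ≤ r + 1) ∧ r ≤ p.2.val ∧ p.2.val ≤ r + 1).card ≤ 4 := by
  have hcard : (Finset.Icc r (r + 1) ×ˢ Finset.Icc r (r + 1)).card = 4 := by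
    rw [Finset.card_product, Nat.card_Icc]
    norm_num [Nat.add_assoc]
  rw [← hcard]
  refine Finset.card_le_card_of_injOn (fun p => (p.1.val, p.2.val)) ?_ ?_
  · rintro ⟨i, j⟩ h
    simp only [Finset.coe_filter, Finset.mem_univ, true_and, Set.mem_ofPred_eq] at h
    simpa [and_assoc, and_left_comm] using h
  · rintro ⟨i, j⟩ _ ⟨i', j'⟩ _ h
    simpa [Fin.ext_iff] using h

/-- Krull's height theorem: if `x` does not lie in some prime containing `G`, then some prime
of height at most the cardinality of `G` contains `G` but not `x`. -/
theorem exists_prime_height_le_card {R : Type*} [CommRing R] [IsNoetherianRing R]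
    (G : Finset R) (x : R) (q : Ideal R) [q.IsPrime] (hG : ∀ g ∈ G, g ∈ q) (hx : x ∉ q) :
    ∃ p : PrimeSpectrum R, (∀ g ∈ G, g ∈ p.asIdeal) ∧ x ∉ p.asIdeal ∧
      Order.height p ≤ (G.card : ℕ∞) := by
  obtain ⟨p, hp, hpq⟩ := Ideal.exists_minimalPrimes_le
    (I := Ideal.span (G : Set R)) (J := q) (Ideal.span_le.2 hG)
  have hprime : p.IsPrime := hp.1.1
  refine ⟨⟨p, hprime⟩, fun g hg => hp.1.2 (Ideal.subset_span hg), fun h => hx (hpq h), ?_⟩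
  rw [← PrimeSpectrum.height_eq_orderHeight]
  exact Ideal.height_le_card_of_mem_minimalPrimes_span_finset hp

/-- For every positive `n ≠ 3` and every `1 ≤ t ≤ n`, the height of the ideal `P_t`
generated by the principal `t`-minors of the generic `n × n` matrix satisfies
`ht(P_t) ≤ C(n+1,2) − C(t+2,2) + 4`. -/
theorem height_prinMinorIdeal_le (K : Type*) [Field K] [IsAlgClosed K]
    (n t : ℕ) (hn : 0 < n) (hn3 : n ≠ 3) (ht1 : 1 ≤ t) (ht2 : t ≤ n) :
    idealHeight (prinMinorIdeal K n t) ≤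
      ((Nat.choose (n + 1) 2 - Nat.choose (t + 2) 2 + 4 : ℕ) : ℕ∞) := by
  classical
  have hrn : t - 1 ≤ n := by omega
  let f : Fin (t - 1) → Fin n := Fin.castLE hrn
  let T : Finset (Fin n × Fin n) :=
    Finset.univ.filter fun p => t + 1 ≤ p.1.val ∧ p.2 ≤ p.1
  let E : Finset (Fin n × Fin n) := Finset.univ.filter fun p =>
    (t - 1 ≤ p.1.val ∧ p.1.val ≤ t - 1 + 1) ∧ t - 1 ≤ p.2.val ∧ p.2.val ≤ t - 1 + 1
  let G : Finset (MvPolynomial (Fin n × Fin n) K) :=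
    T.image MvPolynomial.X ∪ E.image fun p => (genMat K n).scaledSchur f p.1 p.2
  have hGcard : G.card ≤ Nat.choose (n + 1) 2 - Nat.choose (t + 2) 2 + 4 :=
    (Finset.card_union_le _ _).trans <| add_le_add
      (Finset.card_image_le.trans (card_lower_pairs_le n t))
      (Finset.card_image_le.trans (card_corner_pairs_le n (t - 1)))
  let D : Matrix (Fin n) (Fin n) K := diagonal fun i => if i.val < t - 1 then 1 else 0
  let φ : MvPolynomial (Fin n × Fin n) K →+* K := MvPolynomial.eval fun p => D p.1 p.2
  have hφ : (genMat K n).map φ = D := by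
    ext i j
    simp [φ, genMat]
  have hDf : D.submatrix f f = 1 := by
    ext a b
    simp [D, f, diagonal_apply, one_apply, Fin.ext_iff]
  have hker : (RingHom.ker φ).IsPrime := RingHom.ker_isPrime φ
  obtain ⟨p, hGp, hxp, hp⟩ := exists_prime_height_le_card G
    ((genMat K n).submatrix f f).det (RingHom.ker φ) (by
      intro g hg
      rw [RingHom.mem_ker]
      rcases Finset.mem_union.1 hg with hg | hg
      · obtain ⟨⟨i, j⟩, hij, rfl⟩ := Finset.mem_image.1 hg
        simp only [T, Finset.mem_filter, Finset.mem_univ, true_and] at hij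
        have hi : ¬ i.val < t - 1 := by omega
        simp [φ, D, diagonal_apply, hi]
      · obtain ⟨⟨i, j⟩, hij, rfl⟩ := Finset.mem_image.1 hg
        simp only [E, Finset.mem_filter, Finset.mem_univ, true_and] at hij
        have hi : ¬ i.val < t - 1 := by omega
        have hDi (k : Fin n) : D i k = 0 := by simp [D, diagonal_apply, hi]
        rw [scaledSchur_map, hφ]
        simp [scaledSchur, mul_apply, hDi]) (by
      rw [RingHom.mem_ker, φ.map_det]
      change ¬ (((genMat K n).map φ).submatrix f f).det = 0
      simp [hφ, hDf])
  refine (iInf₂_le p ?_).trans (hp.trans (by exact_mod_cast hGcard))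
  refine Ideal.span_le.2 ?_
  rintro _ ⟨s, hs, rfl⟩
  let π := Ideal.Quotient.mk p.asIdeal
  let A := (genMat K n).map π
  refine Ideal.Quotient.eq_zero_iff_mem.1 ?_
  rw [RingHom.map_det]
  change (A.submatrix (Subtype.val : {x // x ∈ s} → Fin n) Subtype.val).det = 0
  have hA (i j : Fin n) (hi : t + 1 ≤ i.val) (hj : j ≤ i) : A i j = 0 :=
    Ideal.Quotient.eq_zero_iff_mem.2 <| hGp _ <| Finset.mem_union_left _ <|
      Finset.mem_image.2 ⟨(i, j), by simp [T, Nat.lt_of_succ_le hi, hj], rfl⟩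
  by_cases hlarge : ∃ i ∈ s, t + 1 ≤ i.val
  · obtain ⟨i, his, hi⟩ := hlarge
    have hle : i ≤ s.max' ⟨i, his⟩ := s.le_max' i his
    exact det_eq_zero_of_row_eq_zero ⟨s.max' ⟨i, his⟩, s.max'_mem _⟩ fun j =>
      hA _ _ (hi.trans hle) (s.le_max' j j.2)
  · push Not at hlarge
    refine det_submatrix_eq_zero_of_scaledSchur A f ?_ _ ?_ (by simp [hs]; omega)
    · intro h
      refine hxp (Ideal.Quotient.eq_zero_iff_mem.1 ?_)
      rw [RingHom.map_det]
      exact h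
    · rintro ⟨i, hi⟩ ⟨j, hj⟩
      have hi' := hlarge i hi
      have hj' := hlarge j hj
      by_cases hir : i.val < t - 1
      · exact scaledSchur_apply_left A f ⟨i, hir⟩ j
      by_cases hjr : j.val < t - 1
      · exact scaledSchur_apply_right A f i ⟨j, hjr⟩
      rw [← scaledSchur_map π]
      refine Ideal.Quotient.eq_zero_iff_mem.2 <| hGp _ <| Finset.mem_union_right _ <|
        Finset.mem_image.2 ⟨(i, j), ?_, rfl⟩
      simp only [E, Finset.mem_filter, Finset.mem_univ, true_and]
      omega
end

section
/- For every n ≥ 2 and every r < n−1, the ideal Q_{n−1} contains no r×r minor of the generic matrix X: for all index sets I, J ⊆ {1,…,n} with |I| = |J| = r < n−1, the minor det X(I; J) does not belong to Q_{n−1}. -/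
open Matrix

/-- If `B * A = 1` and the minor of `A` with rows `p` and columns `q` vanishes, then so does
the complementary minor of `B`. -/
lemma det_submatrix_compl_eq_zero {F ι α β : Type*} [Field F] [Fintype ι] [DecidableEq ι]
    [Fintype α] [DecidableEq α] [Fintype β] [DecidableEq β] {A B : Matrix ι ι F}
    (hBA : B * A = 1) {p q : α → ι} {p' q' : β → ι}
    (hq : Function.Injective q) (hp' : Function.Injective p')
    (hpp' : ∀ i, i ∉ Set.range p' → i ∈ Set.range p)
    (hqq' : ∀ b, q' b ∉ Set.range q)
    (hA : (A.submatrix p q).det = 0) : (B.submatrix q' p').det = 0 := by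
  obtain ⟨v, hv, hAv⟩ := Matrix.exists_mulVec_eq_zero_iff.2 hA
  set V : ι → F := Function.extend q v 0
  have hVq (a : α) : V (q a) = v a := hq.extend_apply _ _ _
  have hV0 (i : ι) (hi : i ∉ Set.range q) : V i = 0 := Function.extend_apply' _ _ _ hi
  set W : ι → F := A *ᵥ V with hW
  have hBW : B *ᵥ W = V := by simp [hW, Matrix.mulVec_mulVec, hBA]
  have hWp (a : α) : W (p a) = 0 := by
    refine Eq.trans ?_ (congrFun hAv a)
    refine (Fintype.sum_of_injective q hq _ _ (fun i hi => ?_) fun b => ?_).symm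
    · simp [hV0 i hi]
    · simp [hVq]
  have hW0 (i : ι) (hi : i ∉ Set.range p') : W i = 0 := by
    obtain ⟨a, rfl⟩ := hpp' i hi
    exact hWp a
  refine Matrix.exists_mulVec_eq_zero_iff.1 ⟨W ∘ p', fun h => hv ?_, ?_⟩
  · have hWz : W = 0 := by
      funext i
      by_cases hi : i ∈ Set.range p'
      · obtain ⟨b, rfl⟩ := hi
        exact congrFun h b
      · exact hW0 i hi
    funext a
    rw [← hVq, ← hBW, hWz]
    simp
  · funext b
    rw [Pi.zero_apply, ← hV0 _ (hqq' b), ← hBW]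
    refine Fintype.sum_of_injective p' hp' _ _ (fun i hi => ?_) fun c => ?_
    · simp [hW0 i hi]
    · simp

/-- Two finite sets of the same cardinality, at least two, admit a matching without
fixed points. -/
lemma exists_injective_mem_ne {ι : Type*} [DecidableEq ι] (U V : Finset ι)
    (h : U.card = V.card) (h2 : 2 ≤ V.card) :
    ∃ f : {x // x ∈ U} → ι, Function.Injective f ∧ ∀ x, f x ∈ V ∧ (x : ι) ≠ f x := by
  obtain ⟨f, hf, hfV⟩ := (Finset.all_card_le_biUnion_card_iff_exists_injective
    (fun x : {x // x ∈ U} => V.erase x)).1 (fun s => by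
      have hsU : s.card ≤ V.card := by
        rw [← h, ← Fintype.card_coe U]
        exact Finset.card_le_univ s
      by_cases hs : s.card ≤ 1
      · rcases s.eq_empty_or_nonempty with rfl | ⟨x, hx⟩
        · simp
        · have h1 := Finset.card_le_card
            (Finset.subset_biUnion_of_mem (fun x : {x // x ∈ U} => V.erase x) hx)
          have h3 := Finset.pred_card_le_card_erase (s := V) (a := (x : ι))
          omega
      · obtain ⟨x, hx, y, hy, hxy⟩ := Finset.one_lt_card.1 (not_le.1 hs)
        refine hsU.trans (Finset.card_le_card fun z hz => Finset.mem_biUnion.2 ?_)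
        by_cases hzx : z = x
        · exact ⟨y, hy, Finset.mem_erase.2 ⟨fun hzy => hxy (Subtype.ext (hzx ▸ hzy)), hz⟩⟩
        · exact ⟨x, hx, Finset.mem_erase.2 ⟨hzx, hz⟩⟩)
  exact ⟨f, hf, fun x => ⟨Finset.mem_of_mem_erase (hfV x),
    (Finset.ne_of_mem_erase (hfV x)).symm⟩⟩

/-- The generic matrix with zero diagonal. -/
noncomputable def hollowGenMat (K : Type*) [Field K] (n : ℕ) :
    Matrix (Fin n) (Fin n) (MvPolynomial (Fin n × Fin n) K) :=
  fun i j => if i = j then 0 else MvPolynomial.X (i, j)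

lemma det_submatrix_hollowGenMat_ne_zero (K : Type*) [Field K] {n : ℕ} {α : Type*} [Fintype α]
    [DecidableEq α] {u f : α → Fin n} (hu : Function.Injective u) (hf : Function.Injective f)
    (huf : ∀ k, u k ≠ f k) : ((hollowGenMat K n).submatrix u f).det ≠ 0 := by
  classical
  intro h
  let ev : MvPolynomial (Fin n × Fin n) K →+* K :=
    MvPolynomial.eval fun ij => if ∃ k, u k = ij.1 ∧ f k = ij.2 then 1 else 0
  have h1 : ((hollowGenMat K n).submatrix u f).map ev = 1 := by
    ext k l
    have hkl : (∃ k', u k' = u k ∧ f k' = f l) ↔ k = l := by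
      constructor
      · rintro ⟨k', h1, h2⟩
        exact (hu h1).symm.trans (hf h2)
      · rintro rfl
        exact ⟨k, rfl, rfl⟩
    by_cases hd : u k = f l
    · have : k ≠ l := by
        rintro rfl
        exact huf k hd
      simp [hollowGenMat, hd, this]
    · simp [hollowGenMat, hd, ev, hkl, Matrix.one_apply]
  have h2 := congrArg ev h
  rw [RingHom.map_det, RingHom.mapMatrix_apply, h1] at h2
  simp at h2

lemma det_hollowGenMat_ne_zero (K : Type*) [Field K] {n : ℕ} (hn : 2 ≤ n) :
    (hollowGenMat K n).det ≠ 0 := by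
  obtain ⟨f, hf, hfne⟩ := exists_injective_mem_ne (Finset.univ : Finset (Fin n)) Finset.univ rfl
    (by simpa using hn)
  let σ : Fin n → Fin n := fun i => f ⟨i, Finset.mem_univ i⟩
  have hσ : Function.Injective σ := fun i j hij => congrArg Subtype.val (hf hij)
  have h := det_submatrix_hollowGenMat_ne_zero K (u := id) (f := σ) Function.injective_id hσ
    fun k => (hfne ⟨k, Finset.mem_univ k⟩).2
  have hperm := Matrix.det_permute' (Equiv.ofBijective σ (Finite.injective_iff_bijective.1 hσ))
    (hollowGenMat K n)
  rw [Equiv.coe_ofBijective] at hperm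
  rw [hperm] at h
  exact right_ne_zero_of_mul h

/-- A ring homomorphism that kills the principal `(n - 1)`-minors and sends the determinant to
a unit kills `Q_{n-1}`. -/
lemma map_eq_zero_of_mem_Qideal {K : Type*} [Field K] {n : ℕ} {F : Type*} [CommRing F]
    (φ : MvPolynomial (Fin n × Fin n) K →+* F) (hunit : IsUnit (φ (genMat K n).det))
    (hP : prinMinorIdeal K n (n - 1) ≤ RingHom.ker φ) {x : MvPolynomial (Fin n × Fin n) K}
    (hx : x ∈ Qideal K n) : φ x = 0 := by
  let ψ : Localization.Away (genMat K n).det →+* F :=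
    IsLocalization.Away.lift (genMat K n).det hunit
  have hψ (y) : ψ (algebraMap _ _ y) = φ y := IsLocalization.Away.lift_eq _ hunit y
  have hle : Ideal.map (algebraMap _ (Localization.Away (genMat K n).det))
      (prinMinorIdeal K n (n - 1)) ≤ RingHom.ker ψ := by
    refine Ideal.map_le_iff_le_comap.2 fun y hy => ?_
    rw [Ideal.mem_comap, RingHom.mem_ker, hψ]
    exact hP hy
  rw [← hψ]
  exact hle hx

/-- For every `n ≥ 2` and every `r < n - 1`, the ideal `Q_{n-1}` contains no
`r × r` minor of the generic matrix `X`. -/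
theorem minor_not_mem_Qideal (K : Type*) [Field K] [IsAlgClosed K]
    (n r : ℕ) (hn : 2 ≤ n) (hr : r < n - 1)
    (I J : Finset (Fin n)) (hI : I.card = r) (hJ : J.card = r) :
    (Matrix.of fun a b : Fin r =>
        genMat K n (I.orderIsoOfFin hI a) (J.orderIsoOfFin hJ b)).det ∉
      Qideal K n := by
  intro hmem
  let R := MvPolynomial (Fin n × Fin n) K
  let F := FractionRing R
  let B : Matrix (Fin n) (Fin n) F := (algebraMap R F).mapMatrix (hollowGenMat K n)
  have hBdet : IsUnit B.det := by
    rw [← RingHom.map_det, isUnit_iff_ne_zero]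
    exact (map_ne_zero_iff _ (IsFractionRing.injective R F)).2 (det_hollowGenMat_ne_zero K hn)
  let φ : R →+* F :=
    MvPolynomial.eval₂Hom ((algebraMap R F).comp MvPolynomial.C) fun ij => B⁻¹ ij.1 ij.2
  have hφ (i j : Fin n) : φ (genMat K n i j) = B⁻¹ i j := MvPolynomial.eval₂Hom_X' _ _ _
  have hφdet {α : Type} [Fintype α] [DecidableEq α] (p q : α → Fin n) :
      φ ((genMat K n).submatrix p q).det = (B⁻¹.submatrix p q).det := by
    rw [RingHom.map_det]
    congr 1
    ext a b
    exact hφ _ _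
  have hunit : IsUnit (φ (genMat K n).det) := by
    have h := hφdet (id : Fin n → Fin n) id
    rw [Matrix.submatrix_id_id, Matrix.submatrix_id_id] at h
    rw [h]
    exact Matrix.isUnit_nonsing_inv_det _ hBdet
  have hP : prinMinorIdeal K n (n - 1) ≤ RingHom.ker φ := by
    refine Ideal.span_le.2 ?_
    rintro _ ⟨s, hs, rfl⟩
    have hcard : sᶜ.card = 1 := by
      rw [Finset.card_compl, Fintype.card_fin]
      omega
    obtain ⟨i, hi⟩ := Finset.card_eq_one.1 hcard
    have hmem_s (j : Fin n) : j ∈ s ↔ j ≠ i := by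
      rw [← not_iff_not, ← Finset.mem_compl, hi]
      simp
    rw [SetLike.mem_coe, RingHom.mem_ker, hφdet]
    refine det_submatrix_compl_eq_zero (Matrix.nonsing_inv_mul B hBdet)
      (p := fun _ : Unit => i) (q := fun _ : Unit => i)
      (Function.injective_of_subsingleton _) Subtype.val_injective ?_ ?_ ?_
    · intro j hj
      have : j = i := by simpa [hmem_s] using hj
      simp [this]
    · rintro ⟨j, hj⟩ ⟨_, rfl⟩
      exact (hmem_s _).1 hj rfl
    · simp [B, hollowGenMat]
  have hzero := map_eq_zero_of_mem_Qideal φ hunit hP hmem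
  have hminor := (hφdet (fun a => (I.orderIsoOfFin hI a : Fin n))
    fun b => (J.orderIsoOfFin hJ b : Fin n)).symm.trans hzero
  have hIc : Iᶜ.card = n - r := by rw [Finset.card_compl, Fintype.card_fin, hI]
  have hJc : Jᶜ.card = n - r := by rw [Finset.card_compl, Fintype.card_fin, hJ]
  obtain ⟨f, hf, hfI⟩ := exists_injective_mem_ne Jᶜ Iᶜ (hJc.trans hIc.symm) (by omega)
  have himage : Finset.univ.image f = Iᶜ := by
    refine Finset.eq_of_subset_of_card_le (fun x hx => ?_) ?_
    · obtain ⟨y, -, rfl⟩ := Finset.mem_image.1 hx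
      exact (hfI y).1
    · rw [Finset.card_image_of_injective _ hf, Finset.card_univ, Fintype.card_coe, hJc, hIc]
  have hB : (B.submatrix (Subtype.val : {x // x ∈ Jᶜ} → Fin n) f).det = 0 := by
    refine det_submatrix_compl_eq_zero (Matrix.mul_nonsing_inv B hBdet)
      (Subtype.val_injective.comp (J.orderIsoOfFin hJ).injective) hf ?_ ?_ hminor
    · intro i hi
      have hiI : i ∈ I := by
        by_contra h
        rw [← Finset.mem_compl, ← himage] at h
        exact hi (by simpa using h)
      exact ⟨(I.orderIsoOfFin hI).symm ⟨i, hiI⟩, by simp⟩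
    · rintro ⟨b, hb⟩ ⟨a, rfl⟩
      exact Finset.mem_compl.1 hb (J.orderIsoOfFin hJ a).2
  refine det_submatrix_hollowGenMat_ne_zero K Subtype.val_injective hf (fun k => (hfI k).2) ?_
  apply IsFractionRing.injective R F
  rw [map_zero, RingHom.map_det]
  exact hB
end

section
/- For n = 4, the ideal P_3 generated by the four principal 3-minors of the generic 4×4 matrix X is a radical ideal of S = K[X]. -/
open Matrix

namespace Polynomial

variable {A : Type*} [CommRing A]

/-- Top coefficients of elements of `(a X + b, c X + d)` lie in `(a, c)`, and constants in this
ideal are multiples of `a d - b c`, provided that `a, c` is a regular sequence. -/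
lemma coeff_of_mem_span_pair_linear {a b c d : A}
    (ha : ∀ h, a * h = 0 → h = 0) (hc : ∀ h, c * h ∈ Ideal.span {a} → h ∈ Ideal.span {a})
    (N : ℕ) : ∀ (u v g : A[X]) (t : A) (m : ℕ), u.natDegree ≤ N → v.natDegree ≤ N →
      g = u * (C a * X + C b) + v * (C c * X + C d) + C (t * (a * d - b * c)) →
      g.natDegree ≤ m →
      (1 ≤ m → g.coeff m ∈ Ideal.span {a, c}) ∧
        (m = 0 → g.coeff 0 ∈ Ideal.span {a * d - b * c}) := by
  have key : ∀ (u v g : A[X]) (t : A) (n : ℕ), u.natDegree ≤ n → v.natDegree ≤ n →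
      g = u * (C a * X + C b) + v * (C c * X + C d) + C (t * (a * d - b * c)) →
      g.coeff (n + 1) = a * u.coeff n + c * v.coeff n := by
    intro u v g t n hu hv hg
    have hu' : u.coeff (n + 1) = 0 := coeff_eq_zero_of_natDegree_lt (by omega)
    have hv' : v.coeff (n + 1) = 0 := coeff_eq_zero_of_natDegree_lt (by omega)
    rw [hg, show u * (C a * X + C b) = u * C a * X + u * C b by ring,
      show v * (C c * X + C d) = v * C c * X + v * C d by ring]
    simp only [coeff_add, coeff_mul_X, coeff_mul_C, coeff_C_succ, hu', hv']
    ring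
  have top : ∀ (u v g : A[X]) (t : A) (n m : ℕ), u.natDegree ≤ n → v.natDegree ≤ n →
      g = u * (C a * X + C b) + v * (C c * X + C d) + C (t * (a * d - b * c)) →
      g.natDegree ≤ m → m < n + 1 → ∃ w, v.coeff n = - w * a ∧ u.coeff n = w * c := by
    intro u v g t n m hu hv hg hm hlt
    have h0 := key u v g t n hu hv hg
    rw [coeff_eq_zero_of_natDegree_lt (by omega)] at h0
    obtain ⟨w, hw⟩ := Ideal.mem_span_singleton'.1
      (hc (v.coeff n) (Ideal.mem_span_singleton'.2 ⟨- u.coeff n, by linear_combination h0⟩))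
    refine ⟨-w, by rw [← hw]; ring, ?_⟩
    have := ha (u.coeff n + w * c) (by linear_combination -h0 + c * hw)
    linear_combination this
  have big : ∀ (u v g : A[X]) (t : A) (n m : ℕ), u.natDegree ≤ n → v.natDegree ≤ n →
      g = u * (C a * X + C b) + v * (C c * X + C d) + C (t * (a * d - b * c)) →
      n + 1 ≤ m → g.coeff m ∈ Ideal.span {a, c} := by
    intro u v g t n m hu hv hg hlt
    obtain ⟨k, rfl⟩ : ∃ k, m = k + 1 := ⟨m - 1, by omega⟩
    rw [key u v g t k (by omega) (by omega) hg, Ideal.mem_span_pair]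
    exact ⟨u.coeff k, v.coeff k, by ring⟩
  induction N with
  | zero =>
    intro u v g t m hu hv hg hm
    refine ⟨fun h => big u v g t 0 m hu hv hg h, ?_⟩
    rintro rfl
    obtain ⟨w, hv0, hu0⟩ := top u v g t 0 0 hu hv hg hm (by omega)
    rw [eq_C_of_natDegree_le_zero hu, eq_C_of_natDegree_le_zero hv, hv0, hu0] at hg
    rw [hg, Ideal.mem_span_singleton']
    refine ⟨t - w, ?_⟩
    simp
    ring
  | succ n ih =>
    intro u v g t m hu hv hg hm
    rcases le_or_gt (n + 1 + 1) m with h | h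
    · exact ⟨fun _ => big u v g t (n + 1) m hu hv hg h, fun h0 => by omega⟩
    · obtain ⟨w, hv0, hu0⟩ := top u v g t (n + 1) m hu hv hg hm h
      refine ih (u - C (w * c) * X ^ (n + 1) - C (w * d) * X ^ n)
        (v + C (w * a) * X ^ (n + 1) + C (w * b) * X ^ n) g t m ?_ ?_ ?_ hm
      · rw [natDegree_le_iff_coeff_eq_zero]
        intro k hk
        rcases eq_or_lt_of_le (Nat.succ_le_of_lt hk) with rfl | hk'
        · simp only [coeff_sub, coeff_C_mul, coeff_X_pow]
          simp [hu0]
        · have : u.coeff k = 0 := coeff_eq_zero_of_natDegree_lt (by omega)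
          have h1 : k ≠ n + 1 := by omega
          have h2 : k ≠ n := by omega
          simp only [coeff_sub, coeff_C_mul, coeff_X_pow]
          simp [this, h1, h2]
      · rw [natDegree_le_iff_coeff_eq_zero]
        intro k hk
        rcases eq_or_lt_of_le (Nat.succ_le_of_lt hk) with rfl | hk'
        · simp only [coeff_add, coeff_C_mul, coeff_X_pow]
          simp [hv0]
        · have : v.coeff k = 0 := coeff_eq_zero_of_natDegree_lt (by omega)
          have h1 : k ≠ n + 1 := by omega
          have h2 : k ≠ n := by omega
          simp only [coeff_add, coeff_C_mul, coeff_X_pow]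
          simp [this, h1, h2]
      · rw [hg]
        simp only [map_mul, map_sub, pow_succ]
        ring

/-- The ideal `(a X + b, c X + d)` is radical when `a, c` is a regular sequence generating a radical
ideal and the resultant `a d - b c` generates a radical ideal. -/
theorem isRadical_span_pair_linear {a b c d : A}
    (ha : ∀ h, a * h = 0 → h = 0) (hc : ∀ h, c * h ∈ Ideal.span {a} → h ∈ Ideal.span {a})
    (hac : (Ideal.span {a, c}).IsRadical) (hdet : (Ideal.span {a * d - b * c}).IsRadical) :
    (Ideal.span {C a * X + C b, C c * X + C d}).IsRadical := by
  have hcoeff : ∀ (g : A[X]) (m : ℕ), g ∈ Ideal.span {C a * X + C b, C c * X + C d} →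
      g.natDegree ≤ m → (1 ≤ m → g.coeff m ∈ Ideal.span {a, c}) ∧
        (m = 0 → g.coeff 0 ∈ Ideal.span {a * d - b * c}) := by
    intro g m hg hm
    obtain ⟨u, v, rfl⟩ := Ideal.mem_span_pair.1 hg
    exact coeff_of_mem_span_pair_linear ha hc (max u.natDegree v.natDegree) u v _ 0 m
      (le_max_left _ _) (le_max_right _ _) (by simp) hm
  have hδ : ∀ x ∈ Ideal.span {a * d - b * c},
      C x ∈ Ideal.span {C a * X + C b, C c * X + C d} := by
    intro x hx
    obtain ⟨y, rfl⟩ := Ideal.mem_span_singleton'.1 hx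
    refine Ideal.mem_span_pair.2 ⟨C (- y * c), C (y * a), ?_⟩
    simp only [map_mul, map_sub, map_neg]
    ring
  suffices H : ∀ (m : ℕ) (h : A[X]), h.natDegree ≤ m →
      ∀ n : ℕ, h ^ n ∈ Ideal.span {C a * X + C b, C c * X + C d} →
        h ∈ Ideal.span {C a * X + C b, C c * X + C d} by
    rintro h ⟨n, hn⟩
    exact H _ h le_rfl n hn
  intro m
  induction m with
  | zero =>
    intro h hh n hn
    rw [eq_C_of_natDegree_le_zero hh] at hn ⊢
    refine hδ _ (hdet ⟨n, ?_⟩)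
    have := (hcoeff _ 0 hn (by rw [← C_pow, natDegree_C])).2 rfl
    rwa [← C_pow, coeff_C_zero] at this
  | succ m ih =>
    intro h hh n hn
    have hlead : h.coeff (m + 1) ∈ Ideal.span {a, c} := by
      rcases Nat.eq_zero_or_pos n with rfl | hpos
      · have h1 := (hcoeff _ 1 hn (by simp)).2
        have h2 := (hcoeff (X : A[X]) 1
          (by simpa using Ideal.mul_mem_left _ (X : A[X]) hn) natDegree_X_le).1 le_rfl
        rw [coeff_X_one] at h2
        rw [(Ideal.eq_top_iff_one _).2 h2]
        trivial
      · refine hac ⟨n, ?_⟩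
        have := (hcoeff _ (n * (m + 1)) hn (natDegree_pow_le_of_le n hh)).1
          (Nat.mul_pos hpos (by omega))
        rwa [coeff_pow_of_natDegree_le hh] at this
    obtain ⟨p, q, hpq⟩ := Ideal.mem_span_pair.1 hlead
    set J := Ideal.span {C a * X + C b, C c * X + C d} with hJ
    set s : A[X] := X ^ m * (C p * (C a * X + C b) + C q * (C c * X + C d)) with hs
    have hsJ : s ∈ J := Ideal.mul_mem_left _ _ (Ideal.mem_span_pair.2 ⟨_, _, rfl⟩)
    have hdeg : (h - s).natDegree ≤ m := by
      rw [natDegree_le_iff_coeff_eq_zero]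
      intro k hk
      have hs' : s = C (h.coeff (m + 1)) * X ^ (m + 1) + C (p * b + q * d) * X ^ m := by
        rw [← hpq, hs]
        simp only [map_mul, map_add, pow_succ]
        ring
      rw [hs']
      rcases eq_or_lt_of_le (Nat.succ_le_of_lt hk) with rfl | hk'
      · simp only [coeff_add, coeff_sub, coeff_C_mul, coeff_X_pow]
        simp
      · have : h.coeff k = 0 := coeff_eq_zero_of_natDegree_lt (by omega)
        have h1 : k ≠ m + 1 := by omega
        have h2 : k ≠ m := by omega
        simp only [coeff_add, coeff_sub, coeff_C_mul, coeff_X_pow]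
        simp [this, h1, h2]
    have hmem : h - s ∈ J := by
      refine ih _ hdeg n ?_
      rw [← Ideal.Quotient.eq_zero_iff_mem] at hn hsJ ⊢
      rw [map_pow, map_sub, hsJ, sub_zero, ← map_pow, hn]
    simpa using J.add_mem hmem hsJ

end Polynomial

open Polynomial in
/-- `Polynomial.isRadical_span_pair_linear` relative to an ideal `O` of coefficients. -/
theorem Ideal.isRadical_map_C_sup_span_pair_linear {A : Type*} [CommRing A] {O : Ideal A}
    {a b c d : A} (ha : ∀ h, a * h ∈ O → h ∈ O)
    (hc : ∀ h, c * h ∈ O ⊔ Ideal.span {a} → h ∈ O ⊔ Ideal.span {a})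
    (hac : (O ⊔ Ideal.span {a, c}).IsRadical)
    (hdet : (O ⊔ Ideal.span {a * d - b * c}).IsRadical) :
    (O.map C ⊔ Ideal.span {C a * X + C b, C c * X + C d}).IsRadical := by
  have hsurj := Ideal.Quotient.mk_surjective (I := O)
  have hmap : ∀ (s : Set A) (x : A),
      Ideal.Quotient.mk O x ∈ Ideal.span (Ideal.Quotient.mk O '' s) ↔ x ∈ O ⊔ Ideal.span s := by
    intro s x
    rw [← Ideal.map_span, ← Ideal.mem_comap, Ideal.comap_map_of_surjective' _ hsurj,
      Ideal.mk_ker, sup_comm]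
  have hrad : ∀ s : Set A, (O ⊔ Ideal.span s).IsRadical →
      (Ideal.span (Ideal.Quotient.mk O '' s)).IsRadical := by
    rintro s hs y ⟨n, hn⟩
    obtain ⟨x, rfl⟩ := hsurj y
    rw [← map_pow, hmap] at hn
    exact (hmap s x).2 (hs ⟨n, hn⟩)
  have key := isRadical_span_pair_linear (a := Ideal.Quotient.mk O a)
    (b := Ideal.Quotient.mk O b) (c := Ideal.Quotient.mk O c) (d := Ideal.Quotient.mk O d)
    (by
      intro y hy
      obtain ⟨x, rfl⟩ := hsurj y
      rw [← map_mul, Ideal.Quotient.eq_zero_iff_mem] at hy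
      exact Ideal.Quotient.eq_zero_iff_mem.2 (ha x hy))
    (by
      intro y hy
      obtain ⟨x, rfl⟩ := hsurj y
      rw [← map_mul, ← Set.image_singleton, hmap] at hy
      rw [← Set.image_singleton, hmap]
      exact hc x hy)
    (by simpa only [Set.image_pair] using hrad _ hac)
    (by simpa only [Set.image_singleton, map_sub, map_mul] using hrad _ hdet)
  have hφ := Polynomial.map_surjective _ hsurj
  have := Ideal.comap_map_of_surjective' (Polynomial.mapRingHom (Ideal.Quotient.mk O)) hφ
    (Ideal.span {C a * X + C b, C c * X + C d})
  rw [Polynomial.ker_mapRingHom, Ideal.mk_ker, Ideal.map_span, Set.image_pair, sup_comm] at this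
  rw [← this]
  simpa using key.comap (Polynomial.mapRingHom (Ideal.Quotient.mk O))

/-- An ideal with two generators linear in `X i`, the others being free of `X i`, is radical if the
ideal of slopes and the ideal of the resultant are. -/
theorem MvPolynomial.isRadical_span_insert_linear {σ R : Type*} [CommRing R] (i : σ)
    {O : Set (MvPolynomial σ R)} {a b c d : MvPolynomial σ R}
    (hO : O ⊆ supported R {i}ᶜ) (ha : a ∈ supported R {i}ᶜ) (hb : b ∈ supported R {i}ᶜ)
    (hc : c ∈ supported R {i}ᶜ) (hd : d ∈ supported R {i}ᶜ)
    (hnza : ∀ h, a * h ∈ Ideal.span O → h ∈ Ideal.span O)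
    (hnzc : ∀ h, c * h ∈ Ideal.span (insert a O) → h ∈ Ideal.span (insert a O))
    (hac : (Ideal.span (insert c (insert a O))).IsRadical)
    (hdet : (Ideal.span (insert (a * d - b * c) O)).IsRadical) :
    (Ideal.span (insert (a * X i + b) (insert (c * X i + d) O))).IsRadical := by
  classical
  let ι : MvPolynomial {j // j ≠ i} R →ₐ[R] MvPolynomial σ R := rename Subtype.val
  let e : Polynomial (MvPolynomial {j // j ≠ i} R) ≃+* MvPolynomial σ R :=
    ((optionEquivLeft R _).symm.trans (renameEquiv R (Equiv.optionSubtypeNe i))).toRingEquiv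
  have heC : ∀ p, e (Polynomial.C p) = ι p := by
    intro p
    induction p using MvPolynomial.induction_on with
    | C r => simp [e, ι]
    | add p q hp hq => simp only [map_add, hp, hq]
    | mul_X p j hp =>
      simp only [map_mul, hp]
      simp [e, ι]
  have heX : e Polynomial.X = X i := by simp [e]
  have hlift : ∀ p ∈ supported R {i}ᶜ, ∃ q, ι q = p := by
    intro p hp
    rw [supported_eq_range_rename] at hp
    exact hp
  have hcontr : ∀ (s : Set (MvPolynomial {j // j ≠ i} R)) (x : MvPolynomial {j // j ≠ i} R),
      ι x ∈ Ideal.span (ι '' s) ↔ x ∈ Ideal.span s := by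
    intro s x
    refine ⟨fun h => ?_, fun h => ?_⟩
    · have hk : ∀ y, killCompl Subtype.val_injective (ι y) = y :=
        killCompl_rename_app Subtype.val_injective
      have := Ideal.mem_map_of_mem (killCompl (R := R) (Subtype.val_injective (p := (· ≠ i)))) h
      rw [Ideal.map_span, Set.image_image] at this
      simpa only [hk, Set.image_id'] using this
    · rw [← Ideal.map_span]
      exact Ideal.mem_map_of_mem ι h
  have hrad : ∀ s : Set (MvPolynomial {j // j ≠ i} R),
      (Ideal.span (ι '' s)).IsRadical → (Ideal.span s).IsRadical := by
    rintro s hs x ⟨n, hn⟩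
    rw [← hcontr, map_pow] at hn
    exact (hcontr s x).1 (hs ⟨n, hn⟩)
  obtain ⟨O, rfl⟩ : ∃ O', ι '' O' = O :=
    ⟨ι ⁻¹' O, Set.image_preimage_eq_of_subset fun p hp => hlift p (hO hp)⟩
  obtain ⟨a, rfl⟩ := hlift a ha
  obtain ⟨b, rfl⟩ := hlift b hb
  obtain ⟨c, rfl⟩ := hlift c hc
  obtain ⟨d, rfl⟩ := hlift d hd
  simp only [← map_mul, ← map_sub, ← Set.image_insert_eq] at hnzc hac hdet
  have key := Ideal.isRadical_map_C_sup_span_pair_linear (O := Ideal.span O)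
    (a := a) (b := b) (c := c) (d := d)
    (fun h hh => (hcontr O h).1 (hnza _ (by rw [← map_mul]; exact (hcontr O _).2 hh)))
    (fun h hh => by
      rw [sup_comm, ← Ideal.span_insert] at hh ⊢
      exact (hcontr _ h).1 (hnzc _ (by rw [← map_mul]; exact (hcontr _ _).2 hh)))
    (by
      have := hrad _ hac
      rwa [Set.insert_comm, Ideal.span_insert, Ideal.span_insert, ← sup_assoc,
        ← Ideal.span_insert, sup_comm] at this)
    (by
      have := hrad _ hdet
      rwa [Ideal.span_insert, sup_comm] at this)
  have hcomp : (⇑e ∘ ⇑Polynomial.C) '' O = ι '' O :=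
    Set.image_congr fun x _ => heC x
  have := key.comap e.symm
  rw [Ideal.comap_symm, Ideal.map_sup, Ideal.map_span, Ideal.map_span, Ideal.map_span,
    ← Set.image_comp, hcomp, Set.image_pair, ← Ideal.span_union, Set.union_comm] at this
  simpa only [map_add, map_mul, heC, heX, Set.insert_union, Set.singleton_union] using this

namespace MonomialOrder

open MvPolynomial

variable {σ : Type*}

section Weighted

variable (m : MonomialOrder σ) (w : σ → ℕ)

/-- The monomials in `σ`, compared by weight first and by `m` among monomials of equal weight. -/
def WeightedSyn (m : MonomialOrder σ) (_ : σ → ℕ) : Type _ := m.syn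

/-- The pair by which monomials are compared in `MonomialOrder.weighted`. -/
noncomputable def WeightedSyn.key (a : WeightedSyn m w) : ℕ ×ₗ m.syn :=
  toLex (Finsupp.weight w (m.toSyn.symm a), a)

lemma WeightedSyn.key_injective : Function.Injective (WeightedSyn.key m w) :=
  fun _ _ h => congrArg (fun p => (ofLex p).2) h

lemma WeightedSyn.key_toSyn (a : σ →₀ ℕ) :
    WeightedSyn.key m w (m.toSyn a) = toLex (Finsupp.weight w a, m.toSyn a) :=
  congrArg toLex (Prod.ext (congrArg (Finsupp.weight w) (m.toSyn.symm_apply_apply a)) rfl)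

noncomputable instance : AddCommMonoid (WeightedSyn m w) :=
  inferInstanceAs (AddCommMonoid m.syn)

noncomputable instance : LinearOrder (WeightedSyn m w) :=
  LinearOrder.lift' (WeightedSyn.key m w) (WeightedSyn.key_injective m w)

instance : IsOrderedAddMonoid (WeightedSyn m w) where
  add_le_add_left a b h c := by
    change WeightedSyn.key m w a ≤ WeightedSyn.key m w b at h
    change WeightedSyn.key m w (a + c) ≤ WeightedSyn.key m w (b + c)
    have hadd : ∀ x : WeightedSyn m w, WeightedSyn.key m w (x + c) =
        WeightedSyn.key m w x + WeightedSyn.key m w c := fun x => by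
      refine congrArg toLex (Prod.ext ?_ rfl)
      exact (congrArg _ (map_add m.toSyn.symm (x : m.syn) c)).trans (map_add _ _ _)
    rw [hadd, hadd]
    exact add_le_add_left h _

instance : WellFoundedLT (WeightedSyn m w) :=
  ⟨InvImage.wf (WeightedSyn.key m w) wellFounded_lt⟩

/-- The refinement by `m` of the partial order given by comparing weights. -/
noncomputable def weighted : MonomialOrder σ where
  syn := WeightedSyn m w
  addCommMonoidSyn := inferInstance
  linearOrderSyn := inferInstance
  isOrderedAddMonoid_syn := inferInstance
  toSyn := (m.toSyn : (σ →₀ ℕ) ≃+ m.syn)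
  toSyn_monotone a b h := by
    change WeightedSyn.key m w (m.toSyn a) ≤ WeightedSyn.key m w (m.toSyn b)
    rw [WeightedSyn.key_toSyn, WeightedSyn.key_toSyn]
    obtain ⟨c, rfl⟩ := exists_add_of_le h
    refine Prod.Lex.toLex_mono (Prod.mk_le_mk.2 ⟨?_, m.toSyn_monotone h⟩)
    simp

lemma weighted_lt_of_weight_lt {a b : σ →₀ ℕ} (h : Finsupp.weight w a < Finsupp.weight w b) :
    a ≺[m.weighted w] b := by
  change WeightedSyn.key m w (m.toSyn a) < WeightedSyn.key m w (m.toSyn b)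
  rw [WeightedSyn.key_toSyn, WeightedSyn.key_toSyn, Prod.Lex.toLex_lt_toLex]
  exact Or.inl h

end Weighted

variable {K : Type*} [Field K] {m : MonomialOrder σ}

lemma exists_reduced {G : Set (MvPolynomial σ K)} (hG : ∀ g ∈ G, g ≠ 0)
    (f : MvPolynomial σ K) :
    ∃ u r, f = u + r ∧ u ∈ Ideal.span G ∧ (r ≠ 0 → ∀ g ∈ G, ¬ m.degree g ≤ m.degree r) := by
  obtain ⟨q, r, hf, -, hr⟩ := m.div_set (B := G)
    (fun g hg => (m.leadingCoeff_ne_zero_iff.2 (hG g hg)).isUnit) f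
  refine ⟨_, r, hf, ?_, fun h0 g hg => hr _ (m.degree_mem_support h0) g hg⟩
  exact Submodule.sum_mem _ fun g _ => Ideal.mul_mem_left _ _ (Ideal.subset_span g.2)

variable [DecidableEq σ]

lemma le_of_le_toFinsupp_of_le_add {a b : σ →₀ ℕ} {l s : List σ} (hls : ∀ v ∈ l, v ∉ s)
    (ha : a ≤ Multiset.toFinsupp (s : Multiset σ))
    (h : a ≤ Multiset.toFinsupp (l : Multiset σ) + b) : a ≤ b := by
  intro i
  have h1 := ha i
  have h2 := h i
  simp only [Finsupp.add_apply, Multiset.toFinsupp_apply, Multiset.coe_count] at h1 h2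
  by_cases hi : i ∈ l
  · rw [List.count_eq_zero_of_not_mem (hls i hi)] at h1
    omega
  · rw [List.count_eq_zero_of_not_mem hi] at h2
    omega

variable (m) in
/-- The leading monomial of `f` is the product of the variables in the list `l`. -/
def HasLead (f : MvPolynomial σ K) (l : List σ) : Prop :=
  f ≠ 0 ∧ m.degree f = Multiset.toFinsupp (l : Multiset σ)

variable (m) in
/-- `G` is a Gröbner basis of the ideal it generates, all of whose leading monomials divide the
product of the variables in the list `s`. -/
structure IsLeadBasis (G : Set (MvPolynomial σ K)) (s : List σ) : Prop where
  ne_zero : ∀ g ∈ G, g ≠ 0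
  degree_le : ∀ g ∈ G, m.degree g ≤ Multiset.toFinsupp (s : Multiset σ)
  exists_degree_le : ∀ f ∈ Ideal.span G, f ≠ 0 → ∃ g ∈ G, m.degree g ≤ m.degree f

namespace IsLeadBasis

lemma empty : m.IsLeadBasis (∅ : Set (MvPolynomial σ K)) [] where
  ne_zero := by simp
  degree_le := by simp
  exists_degree_le f hf h0 := absurd (by simpa using hf) h0

variable {G : Set (MvPolynomial σ K)} {g : MvPolynomial σ K} {l s : List σ}

lemma insert (hG : m.IsLeadBasis G s) (hg : m.HasLead g l) (hls : ∀ v ∈ l, v ∉ s) :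
    m.IsLeadBasis (insert g G) (l ++ s) := by
  obtain ⟨hg0, hgl⟩ := hg
  have hadd : Multiset.toFinsupp ((l ++ s : List σ) : Multiset σ) =
      Multiset.toFinsupp (l : Multiset σ) + Multiset.toFinsupp (s : Multiset σ) := by
    rw [← Multiset.coe_add, map_add]
  refine ⟨?_, ?_, fun f hf h0 => ?_⟩
  · rintro g' (rfl | hg')
    exacts [hg0, hG.ne_zero _ hg']
  · rw [hadd]
    rintro g' (rfl | hg')
    exacts [hgl.le.trans le_self_add, (hG.degree_le _ hg').trans le_add_self]
  obtain ⟨a, z, hz, rfl⟩ := Ideal.mem_span_insert.1 hf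
  obtain ⟨u, r, rfl, hu, hr⟩ := exists_reduced (m := m) hG.ne_zero a
  have hv : u * g + z ∈ Ideal.span G := Ideal.add_mem _ (Ideal.mul_mem_right _ _ hu) hz
  rw [show (u + r) * g + z = r * g + (u * g + z) by ring] at h0 ⊢
  generalize u * g + z = v at hv h0 ⊢
  by_cases hr0 : r = 0
  · subst hr0
    simp only [zero_mul, zero_add] at h0 ⊢
    obtain ⟨g', hg', hle⟩ := hG.exists_degree_le v hv h0
    exact ⟨g', Set.mem_insert_of_mem _ hg', hle⟩
  have hrg : m.degree (r * g) = m.degree g + m.degree r := by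
    rw [degree_mul hr0 hg0, add_comm]
  have hmem : ∃ g' ∈ Insert.insert g G, m.degree g' ≤ m.degree (r * g) :=
    ⟨g, Set.mem_insert _ _, by rw [hrg]; exact le_self_add⟩
  by_cases hv0 : v = 0
  · simpa [hv0] using hmem
  obtain ⟨g', hg', hle⟩ := hG.exists_degree_le v hv hv0
  have hne : m.degree (r * g) ≠ m.degree v := by
    intro heq
    rw [← heq, hrg, hgl] at hle
    exact hr hr0 g' hg' (le_of_le_toFinsupp_of_le_add hls (hG.degree_le _ hg') hle)
  rcases lt_or_gt_of_ne (m.toSyn.injective.ne hne) with hlt | hlt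
  · rw [add_comm, degree_add_of_lt hlt]
    exact ⟨g', Set.mem_insert_of_mem _ hg', hle⟩
  · rw [degree_add_of_lt hlt]
    exact hmem

lemma mem_of_mul_mem (hG : m.IsLeadBasis G s) (hg : m.HasLead g l) (hls : ∀ v ∈ l, v ∉ s)
    (h : MvPolynomial σ K) (hmem : g * h ∈ Ideal.span G) : h ∈ Ideal.span G := by
  obtain ⟨u, r, rfl, hu, hr⟩ := exists_reduced (m := m) hG.ne_zero h
  rw [mul_add, Ideal.add_mem_iff_right _ (Ideal.mul_mem_left _ _ hu)] at hmem
  by_cases hr0 : r = 0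
  · simpa [hr0] using hu
  obtain ⟨g', hg', hle⟩ := hG.exists_degree_le _ hmem (mul_ne_zero hg.1 hr0)
  rw [degree_mul hg.1 hr0, hg.2] at hle
  exact absurd (le_of_le_toFinsupp_of_le_add hls (hG.degree_le _ hg') hle) (hr hr0 g' hg')

lemma isRadical (hG : m.IsLeadBasis G s) (hs : s.Nodup) : (Ideal.span G).IsRadical := by
  rintro h ⟨n, hn⟩
  obtain ⟨u, r, rfl, hu, hr⟩ := exists_reduced (m := m) hG.ne_zero h
  by_cases hr0 : r = 0
  · simpa [hr0] using hu
  have hrn : r ^ n ∈ Ideal.span G := by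
    rw [← Ideal.Quotient.eq_zero_iff_mem] at hn hu ⊢
    rwa [map_pow, map_add, hu, zero_add, ← map_pow] at hn
  obtain ⟨g, hg, hle⟩ := hG.exists_degree_le _ hrn (pow_ne_zero _ hr0)
  rw [degree_pow] at hle
  refine absurd (fun i => ?_) (hr hr0 g hg)
  have h1 := hle i
  have h2 := hG.degree_le g hg i
  rw [Multiset.toFinsupp_apply, Multiset.coe_count] at h2
  have h3 := List.nodup_iff_count_le_one.1 hs i
  rcases Nat.eq_zero_or_pos (m.degree r i) with h4 | h4
  · simpa [h4] using h1
  · omega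

theorem isRadical_span_insert_linear (hG : m.IsLeadBasis G s) (i : σ)
    {a b c d : MvPolynomial σ K} {la lc : List σ}
    (hla : m.HasLead a la) (hlc : m.HasLead c lc) (hs : (lc ++ (la ++ s)).Nodup)
    (hO : G ⊆ supported K {i}ᶜ) (ha : a ∈ supported K {i}ᶜ) (hb : b ∈ supported K {i}ᶜ)
    (hc : c ∈ supported K {i}ᶜ) (hd : d ∈ supported K {i}ᶜ)
    (hdet : (Ideal.span (Insert.insert (a * d - b * c) G)).IsRadical) :
    (Ideal.span (Insert.insert (a * X i + b) (Insert.insert (c * X i + d) G))).IsRadical := by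
  have hdisjc := (List.nodup_append'.1 hs).2.2
  have hdisja := (List.nodup_append'.1 (List.nodup_append'.1 hs).2.1).2.2
  have hGa := hG.insert hla fun v h h' => hdisja h h'
  exact MvPolynomial.isRadical_span_insert_linear i hO ha hb hc hd
    (hG.mem_of_mul_mem hla fun v h h' => hdisja h h')
    (hGa.mem_of_mul_mem hlc fun v h h' => hdisjc h h')
    ((hGa.insert hlc fun v h h' => hdisjc h h').isRadical hs) hdet

end IsLeadBasis

end MonomialOrder

theorem Ideal.isRadical_span_singleton_mul {R : Type*} [CommRing R] {p q : R}
    (hp : (Ideal.span {p}).IsRadical) (hq : (Ideal.span {q}).IsRadical)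
    (h : ∀ x, q * x ∈ Ideal.span {p} → x ∈ Ideal.span {p}) :
    (Ideal.span {p * q}).IsRadical := by
  rintro x ⟨n, hn⟩
  have hpx : x ∈ Ideal.span {p} :=
    hp ⟨n, Ideal.mem_span_singleton.2 ((dvd_mul_right p q).trans (Ideal.mem_span_singleton.1 hn))⟩
  have hqx : x ∈ Ideal.span {q} :=
    hq ⟨n, Ideal.mem_span_singleton.2 ((dvd_mul_left q p).trans (Ideal.mem_span_singleton.1 hn))⟩
  obtain ⟨y, rfl⟩ := Ideal.mem_span_singleton.1 hqx
  rw [mul_comm p q]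
  exact Ideal.mem_span_singleton.2
    (mul_dvd_mul_left q (Ideal.mem_span_singleton.1 (h y hpx)))

namespace MvPolynomial

open MonomialOrder

variable {σ : Type*} (K : Type*)

/-- The polynomial given by a list of integer coefficients and lists of variables. -/
noncomputable def ofTerms [CommRing K] (L : List (ℤ × List σ)) : MvPolynomial σ K :=
  (L.map fun t => (t.1 : MvPolynomial σ K) * (t.2.map X).prod).sum

lemma ofTerms_mem_supported [CommRing K] {L : List (ℤ × List σ)} {i : σ}
    (hL : ∀ t ∈ L, i ∉ t.2) : ofTerms K L ∈ supported K {i}ᶜ := by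
  refine Subalgebra.list_sum_mem _ fun p hp => ?_
  obtain ⟨t, ht, rfl⟩ := List.mem_map.1 hp
  refine Subalgebra.mul_mem _ (intCast_mem _ _) (Subalgebra.list_prod_mem _ fun p hp => ?_)
  obtain ⟨v, hv, rfl⟩ := List.mem_map.1 hp
  refine Algebra.subset_adjoin (Set.mem_image_of_mem _ ?_)
  rintro rfl
  exact hL t ht hv

variable [DecidableEq σ]

lemma list_prod_X [CommRing K] (l : List σ) :
    (l.map X).prod = (monomial (Multiset.toFinsupp (l : Multiset σ)) 1 : MvPolynomial σ K) := by
  induction l with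
  | nil => simp
  | cons v l ih =>
    rw [List.map_cons, List.prod_cons, ih, X, monomial_mul, ← Multiset.cons_coe,
      ← Multiset.singleton_add, map_add, Multiset.toFinsupp_singleton, one_mul]

lemma weight_toFinsupp (w : σ → ℕ) (l : List σ) :
    Finsupp.weight w (Multiset.toFinsupp (l : Multiset σ)) = (l.map w).sum := by
  induction l with
  | nil => simp
  | cons v l ih =>
    rw [← Multiset.cons_coe, ← Multiset.singleton_add, map_add, map_add, ih,
      Multiset.toFinsupp_singleton, Finsupp.weight_single, List.map_cons, List.sum_cons, one_smul]

lemma weight_lt_of_mem_support_ofTerms [CommRing K] {w : σ → ℕ} {n : ℕ}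
    {L : List (ℤ × List σ)} (hL : ∀ t ∈ L, (t.2.map w).sum < n) {d : σ →₀ ℕ}
    (hd : d ∈ (ofTerms K L).support) : Finsupp.weight w d < n := by
  induction L with
  | nil => simp [ofTerms] at hd
  | cons t L ih =>
    rw [ofTerms, List.map_cons, List.sum_cons] at hd
    rcases Finset.mem_union.1 (support_add hd) with h | h
    · rw [list_prod_X, ← map_intCast (C : K →+* MvPolynomial σ K), C_mul_monomial] at h
      rw [Finset.mem_singleton.1 (support_monomial_subset h), weight_toFinsupp]
      exact hL t (by simp)
    · exact ih (fun t ht => hL t (by simp [ht])) h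

/-- A term of a polynomial that is heavier than all others is the leading one. -/
lemma hasLead_ofTerms [Field K] (m : MonomialOrder σ) (w : σ → ℕ) {L : List (ℤ × List σ)}
    {t : ℤ × List σ} (ht : t ∈ L) (hc : t.1 = 1 ∨ t.1 = -1)
    (hL : ∀ t' ∈ L.erase t, (t'.2.map w).sum < (t.2.map w).sum) :
    (m.weighted w).HasLead (ofTerms K L) t.2 := by
  have hperm : ofTerms K L = monomial (Multiset.toFinsupp (t.2 : Multiset σ)) (t.1 : K) +
      ofTerms K (L.erase t) := by
    rw [ofTerms, ((List.perm_cons_erase ht).map _).sum_eq, List.map_cons, List.sum_cons,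
      list_prod_X, ← map_intCast (C : K →+* MvPolynomial σ K), C_mul_monomial, mul_one]
    rfl
  have hw : ∀ d ∈ (ofTerms K (L.erase t)).support,
      d ≺[m.weighted w] Multiset.toFinsupp (t.2 : Multiset σ) := fun d hd =>
    weighted_lt_of_weight_lt m w (by
      rw [weight_toFinsupp]
      exact weight_lt_of_mem_support_ofTerms K hL hd)
  have hcoeff : (ofTerms K L).coeff (Multiset.toFinsupp (t.2 : Multiset σ)) ≠ 0 := by
    rw [hperm, coeff_add, coeff_monomial, if_pos rfl,
      notMem_support_iff.1 fun h => lt_irrefl _ (hw _ h), add_zero]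
    rcases hc with h | h <;> simp [h]
  refine ⟨fun h => hcoeff (by rw [h, coeff_zero]), ?_⟩
  refine (m.weighted w).toSyn.injective (le_antisymm ?_ ?_)
  · rw [degree_le_iff]
    intro d hd
    rw [hperm] at hd
    rcases Finset.mem_union.1 (support_add hd) with h | h
    · rw [Finset.mem_singleton.1 (support_monomial_subset h)]
    · exact (hw d h).le
  · exact (m.weighted w).le_degree (mem_support_iff.2 hcoeff)

end MvPolynomial

universe u in
lemma MonomialOrder.nonempty_monomialOrder (σ : Type u) : Nonempty (MonomialOrder.{u, u} σ) := by
  obtain ⟨lin, wf⟩ := exists_wellFoundedLT σ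
  exact ⟨@MonomialOrder.lex σ (inferInstanceAs (LinearOrder σᵒᵈ))
    (inferInstanceAs (WellFoundedGT σᵒᵈ))⟩

namespace PrincipalMinors

/-- The principal minor of a `4 × 4` matrix avoiding index `0`. -/
def minorZero : List (ℤ × List (Fin 4 × Fin 4)) :=
  [(1, [(1, 1), (2, 2), (3, 3)]), (-1, [(1, 1), (2, 3), (3, 2)]), (-1, [(1, 2), (2, 1), (3, 3)]),
    (1, [(1, 2), (2, 3), (3, 1)]), (1, [(1, 3), (2, 1), (3, 2)]), (-1, [(1, 3), (2, 2), (3, 1)])]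

/-- The principal minor of a `4 × 4` matrix avoiding index `1`. -/
def minorOne : List (ℤ × List (Fin 4 × Fin 4)) :=
  [(1, [(0, 0), (2, 2), (3, 3)]), (-1, [(0, 0), (2, 3), (3, 2)]), (-1, [(0, 2), (2, 0), (3, 3)]),
    (1, [(0, 2), (2, 3), (3, 0)]), (1, [(0, 3), (2, 0), (3, 2)]), (-1, [(0, 3), (2, 2), (3, 0)])]

/-- The coefficient of `x₀₁` in the principal minor avoiding index `2`. -/
def slopeTwo : List (ℤ × List (Fin 4 × Fin 4)) :=
  [(-1, [(1, 0), (3, 3)]), (1, [(1, 3), (3, 0)])]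

/-- The part free of `x₀₁` of the principal minor avoiding index `2`. -/
def constTwo : List (ℤ × List (Fin 4 × Fin 4)) :=
  [(1, [(0, 0), (1, 1), (3, 3)]), (-1, [(0, 0), (1, 3), (3, 1)]), (1, [(0, 3), (1, 0), (3, 1)]),
    (-1, [(0, 3), (1, 1), (3, 0)])]

/-- The coefficient of `x₀₁` in the principal minor avoiding index `3`. -/
def slopeThree : List (ℤ × List (Fin 4 × Fin 4)) :=
  [(-1, [(1, 0), (2, 2)]), (1, [(1, 2), (2, 0)])]

/-- The part free of `x₀₁` of the principal minor avoiding index `3`. -/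
def constThree : List (ℤ × List (Fin 4 × Fin 4)) :=
  [(1, [(0, 0), (1, 1), (2, 2)]), (-1, [(0, 0), (1, 2), (2, 1)]), (1, [(0, 2), (1, 0), (2, 1)]),
    (-1, [(0, 2), (1, 1), (2, 0)])]

/-- The resultant with respect to `x₀₁` of the principal minors avoiding `2` and `3`. -/
def resultant : List (ℤ × List (Fin 4 × Fin 4)) :=
  [(1, [(0, 0), (1, 0), (1, 2), (2, 1), (3, 3)]), (-1, [(0, 0), (1, 0), (1, 3), (2, 2), (3, 1)]),
    (-1, [(0, 0), (1, 1), (1, 2), (2, 0), (3, 3)]), (1, [(0, 0), (1, 1), (1, 3), (2, 2), (3, 0)]),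
    (1, [(0, 0), (1, 2), (1, 3), (2, 0), (3, 1)]), (-1, [(0, 0), (1, 2), (1, 3), (2, 1), (3, 0)]),
    (-1, [(0, 2), (1, 0), (1, 0), (2, 1), (3, 3)]), (1, [(0, 2), (1, 0), (1, 1), (2, 0), (3, 3)]),
    (1, [(0, 2), (1, 0), (1, 3), (2, 1), (3, 0)]), (-1, [(0, 2), (1, 1), (1, 3), (2, 0), (3, 0)]),
    (1, [(0, 3), (1, 0), (1, 0), (2, 2), (3, 1)]), (-1, [(0, 3), (1, 0), (1, 1), (2, 2), (3, 0)]),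
    (-1, [(0, 3), (1, 0), (1, 2), (2, 0), (3, 1)]), (1, [(0, 3), (1, 1), (1, 2), (2, 0), (3, 0)])]

/-- The coefficient of `x₂₃` in `minorZero`. -/
def slopeZero : List (ℤ × List (Fin 4 × Fin 4)) :=
  [(-1, [(1, 1), (3, 2)]), (1, [(1, 2), (3, 1)])]

/-- The part of `minorZero` free of `x₂₃`. -/
def constZero : List (ℤ × List (Fin 4 × Fin 4)) :=
  [(1, [(1, 1), (2, 2), (3, 3)]), (-1, [(1, 2), (2, 1), (3, 3)]), (1, [(1, 3), (2, 1), (3, 2)]),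
    (-1, [(1, 3), (2, 2), (3, 1)])]

/-- The coefficient of `x₂₃` in `minorOne`. -/
def slopeOne : List (ℤ × List (Fin 4 × Fin 4)) :=
  [(-1, [(0, 0), (3, 2)]), (1, [(0, 2), (3, 0)])]

/-- The part of `minorOne` free of `x₂₃`. -/
def constOne : List (ℤ × List (Fin 4 × Fin 4)) :=
  [(1, [(0, 0), (2, 2), (3, 3)]), (-1, [(0, 2), (2, 0), (3, 3)]), (1, [(0, 3), (2, 0), (3, 2)]),
    (-1, [(0, 3), (2, 2), (3, 0)])]

/-- The coefficient of `x₀₀` in `resultant`. -/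
def slopeResultant : List (ℤ × List (Fin 4 × Fin 4)) :=
  [(1, [(1, 0), (1, 2), (2, 1), (3, 3)]), (-1, [(1, 0), (1, 3), (2, 2), (3, 1)]),
    (-1, [(1, 1), (1, 2), (2, 0), (3, 3)]), (1, [(1, 1), (1, 3), (2, 2), (3, 0)]),
    (1, [(1, 2), (1, 3), (2, 0), (3, 1)]), (-1, [(1, 2), (1, 3), (2, 1), (3, 0)])]

/-- The part of `resultant` free of `x₀₀`. -/
def constResultant : List (ℤ × List (Fin 4 × Fin 4)) :=
  [(-1, [(0, 2), (1, 0), (1, 0), (2, 1), (3, 3)]), (1, [(0, 2), (1, 0), (1, 1), (2, 0), (3, 3)]),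
    (1, [(0, 2), (1, 0), (1, 3), (2, 1), (3, 0)]), (-1, [(0, 2), (1, 1), (1, 3), (2, 0), (3, 0)]),
    (1, [(0, 3), (1, 0), (1, 0), (2, 2), (3, 1)]), (-1, [(0, 3), (1, 0), (1, 1), (2, 2), (3, 0)]),
    (-1, [(0, 3), (1, 0), (1, 2), (2, 0), (3, 1)]), (1, [(0, 3), (1, 1), (1, 2), (2, 0), (3, 0)])]

/-- The coefficient of `x₀₀` in the resultant of `minorZero` and `minorOne` with respect to
`x₂₃`. -/
def slopeResultantTwo : List (ℤ × List (Fin 4 × Fin 4)) :=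
  [(-1, [(1, 2), (2, 1), (3, 2), (3, 3)]), (1, [(1, 2), (2, 2), (3, 1), (3, 3)]),
    (1, [(1, 3), (2, 1), (3, 2), (3, 2)]), (-1, [(1, 3), (2, 2), (3, 1), (3, 2)])]

/-- The part free of `x₀₀` of the resultant of `minorZero` and `minorOne` with respect to `x₂₃`. -/
def constResultantTwo : List (ℤ × List (Fin 4 × Fin 4)) :=
  [(1, [(0, 2), (1, 1), (2, 0), (3, 2), (3, 3)]), (-1, [(0, 2), (1, 1), (2, 2), (3, 0), (3, 3)]),
    (-1, [(0, 2), (1, 2), (2, 0), (3, 1), (3, 3)]), (1, [(0, 2), (1, 2), (2, 1), (3, 0), (3, 3)]),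
    (-1, [(0, 2), (1, 3), (2, 1), (3, 0), (3, 2)]), (1, [(0, 2), (1, 3), (2, 2), (3, 0), (3, 1)]),
    (-1, [(0, 3), (1, 1), (2, 0), (3, 2), (3, 2)]), (1, [(0, 3), (1, 1), (2, 2), (3, 0), (3, 2)]),
    (1, [(0, 3), (1, 2), (2, 0), (3, 1), (3, 2)]), (-1, [(0, 3), (1, 2), (2, 2), (3, 0), (3, 1)])]

/-- The minor of a `4 × 4` matrix on the rows `1, 2, 3` and the columns `0, 1, 2`. -/
def cornerMinor : List (ℤ × List (Fin 4 × Fin 4)) :=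
  [(1, [(1, 0), (2, 1), (3, 2)]), (-1, [(1, 0), (2, 2), (3, 1)]), (-1, [(1, 1), (2, 0), (3, 2)]),
    (1, [(1, 1), (2, 2), (3, 0)]), (1, [(1, 2), (2, 0), (3, 1)]), (-1, [(1, 2), (2, 1), (3, 0)])]

/-- The cofactor of `cornerMinor` in the last resultant. -/
def cofactor : List (ℤ × List (Fin 4 × Fin 4)) :=
  [(-1, [(0, 2), (1, 0), (1, 2), (2, 1), (3, 3), (3, 3)]),
    (1, [(0, 2), (1, 0), (1, 3), (2, 1), (3, 2), (3, 3)]),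
    (1, [(0, 2), (1, 1), (1, 2), (2, 0), (3, 3), (3, 3)]),
    (-1, [(0, 2), (1, 1), (1, 3), (2, 2), (3, 0), (3, 3)]),
    (-1, [(0, 2), (1, 2), (1, 3), (2, 0), (3, 1), (3, 3)]),
    (1, [(0, 2), (1, 2), (1, 3), (2, 1), (3, 0), (3, 3)]),
    (-1, [(0, 2), (1, 3), (1, 3), (2, 1), (3, 0), (3, 2)]),
    (1, [(0, 2), (1, 3), (1, 3), (2, 2), (3, 0), (3, 1)]),
    (1, [(0, 3), (1, 0), (1, 2), (2, 2), (3, 1), (3, 3)]),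
    (-1, [(0, 3), (1, 0), (1, 3), (2, 2), (3, 1), (3, 2)]),
    (-1, [(0, 3), (1, 1), (1, 2), (2, 0), (3, 2), (3, 3)]),
    (1, [(0, 3), (1, 1), (1, 3), (2, 2), (3, 0), (3, 2)]),
    (1, [(0, 3), (1, 2), (1, 3), (2, 0), (3, 1), (3, 2)]),
    (-1, [(0, 3), (1, 2), (1, 3), (2, 2), (3, 0), (3, 1)])]

open MvPolynomial MonomialOrder

variable (K : Type*)

theorem resultant_eq [CommRing K] :
    ofTerms K slopeTwo * ofTerms K constThree - ofTerms K constTwo * ofTerms K slopeThree =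
      ofTerms K resultant := by
  simp only [ofTerms, slopeTwo, constTwo, slopeThree, constThree, resultant, List.map_cons,
    List.map_nil, List.sum_cons, List.sum_nil, List.prod_cons, List.prod_nil, Int.cast_one,
    Int.cast_neg]
  ring

theorem minorZero_eq [CommRing K] :
    ofTerms K minorZero = ofTerms K slopeZero * X (2, 3) + ofTerms K constZero := by
  simp only [ofTerms, minorZero, slopeZero, constZero, List.map_cons,
    List.map_nil, List.sum_cons, List.sum_nil, List.prod_cons, List.prod_nil, Int.cast_one,
    Int.cast_neg]
  ring

theorem minorOne_eq [CommRing K] :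
    ofTerms K minorOne = ofTerms K slopeOne * X (2, 3) + ofTerms K constOne := by
  simp only [ofTerms, minorOne, slopeOne, constOne, List.map_cons,
    List.map_nil, List.sum_cons, List.sum_nil, List.prod_cons, List.prod_nil, Int.cast_one,
    Int.cast_neg]
  ring

theorem resultant_eq_linear [CommRing K] :
    ofTerms K resultant = ofTerms K slopeResultant * X (0, 0) + ofTerms K constResultant := by
  simp only [ofTerms, resultant, slopeResultant, constResultant, List.map_cons,
    List.map_nil, List.sum_cons, List.sum_nil, List.prod_cons, List.prod_nil, Int.cast_one,
    Int.cast_neg]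
  ring

theorem resultantTwo_eq_linear [CommRing K] :
    ofTerms K slopeZero * ofTerms K constOne - ofTerms K constZero * ofTerms K slopeOne =
      ofTerms K slopeResultantTwo * X (0, 0) + ofTerms K constResultantTwo := by
  simp only [ofTerms, slopeZero, constZero, slopeOne, constOne, slopeResultantTwo,
    constResultantTwo, List.map_cons, List.map_nil,
    List.sum_cons, List.sum_nil, List.prod_cons, List.prod_nil, Int.cast_one,
    Int.cast_neg]
  ring

theorem iteratedResultant_eq [CommRing K] :
    ofTerms K slopeResultant * ofTerms K constResultantTwo -
        ofTerms K constResultant * ofTerms K slopeResultantTwo =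
      ofTerms K cornerMinor * ofTerms K cofactor := by
  simp only [ofTerms, slopeResultant, constResultant, slopeResultantTwo,
    constResultantTwo, cornerMinor, cofactor, List.map_cons, List.map_nil,
    List.sum_cons, List.sum_nil, List.prod_cons, List.prod_nil, Int.cast_one,
    Int.cast_neg]
  ring

theorem isRadical_span_cornerMinor_mul_cofactor [Field K] :
    (Ideal.span {ofTerms K cornerMinor * ofTerms K cofactor}).IsRadical := by
  obtain ⟨m⟩ := nonempty_monomialOrder (Fin 4 × Fin 4)
  have hM := hasLead_ofTerms K m
    (fun v => ![![0, 0, 1, 0], ![0, 1, 0, 1], ![1, 0, 1, 0], ![0, 1, 1, 0]] v.1 v.2)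
    (L := cornerMinor) (t := (-1, [(1, 1), (2, 0), (3, 2)])) (by decide) (by decide) (by decide)
  have hN := hasLead_ofTerms K m
    (fun v => ![![0, 0, 1, 0], ![0, 1, 0, 1], ![1, 0, 1, 0], ![0, 1, 1, 0]] v.1 v.2)
    (L := cofactor) (t := (1, [(0, 2), (1, 3), (1, 3), (2, 2), (3, 0), (3, 1)]))
    (by decide) (by decide) (by decide)
  have hN' := hasLead_ofTerms K m
    (fun v => ![![0, 0, 0, 0], ![1, 0, 1, 0], ![0, 0, 1, 0], ![0, 1, 0, 0]] v.1 v.2)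
    (L := cofactor) (t := (1, [(0, 3), (1, 0), (1, 2), (2, 2), (3, 1), (3, 3)]))
    (by decide) (by decide) (by decide)
  have hbM := IsLeadBasis.empty.insert hM (by simp)
  have hbN' := IsLeadBasis.empty.insert hN' (by simp)
  rw [insert_empty_eq] at hbM hbN'
  exact Ideal.isRadical_span_singleton_mul (hbM.isRadical (by decide)) (hbN'.isRadical (by decide))
    (hbM.mem_of_mul_mem hN (by decide))

theorem isRadical_span_resultants [Field K] :
    (Ideal.span {
      ofTerms K slopeZero * ofTerms K constOne - ofTerms K constZero * ofTerms K slopeOne,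
      ofTerms K resultant}).IsRadical := by
  obtain ⟨m⟩ := nonempty_monomialOrder (Fin 4 × Fin 4)
  have ha := hasLead_ofTerms K m
    (fun v => ![![0, 0, 0, 0], ![1, 2, 0, 1], ![2, 0, 2, 0], ![0, 1, 2, 2]] v.1 v.2)
    (L := slopeResultant) (t := (-1, [(1, 1), (1, 2), (2, 0), (3, 3)]))
    (by decide) (by decide) (by decide)
  have hc := hasLead_ofTerms K m
    (fun v => ![![0, 0, 0, 0], ![1, 2, 0, 1], ![2, 0, 2, 0], ![0, 1, 2, 2]] v.1 v.2)
    (L := slopeResultantTwo) (t := (-1, [(1, 3), (2, 2), (3, 1), (3, 2)]))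
    (by decide) (by decide) (by decide)
  have := IsLeadBasis.empty.isRadical_span_insert_linear (0, 0) ha hc (by decide) (by simp)
    (ofTerms_mem_supported K (by decide))
    (ofTerms_mem_supported K (L := constResultant) (by decide))
    (ofTerms_mem_supported K (by decide))
    (ofTerms_mem_supported K (L := constResultantTwo) (by decide))
    (by
      rw [iteratedResultant_eq, insert_empty_eq]
      exact isRadical_span_cornerMinor_mul_cofactor K)
  rwa [insert_empty_eq, ← resultant_eq_linear, ← resultantTwo_eq_linear, Set.pair_comm] at this

theorem isRadical_span_minorZero_minorOne_resultant [Field K] :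
    (Ideal.span {ofTerms K minorZero, ofTerms K minorOne, ofTerms K resultant}).IsRadical := by
  obtain ⟨m⟩ := nonempty_monomialOrder (Fin 4 × Fin 4)
  have hδ := hasLead_ofTerms K m
    (fun v => ![![1, 0, 1, 0], ![1, 2, 2, 0], ![0, 2, 0, 0], ![2, 0, 1, 2]] v.1 v.2)
    (L := resultant) (t := (1, [(0, 0), (1, 0), (1, 2), (2, 1), (3, 3)]))
    (by decide) (by decide) (by decide)
  have ha := hasLead_ofTerms K m
    (fun v => ![![1, 0, 1, 0], ![1, 2, 2, 0], ![0, 2, 0, 0], ![2, 0, 1, 2]] v.1 v.2)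
    (L := slopeZero) (t := (-1, [(1, 1), (3, 2)])) (by decide) (by decide) (by decide)
  have hc := hasLead_ofTerms K m
    (fun v => ![![1, 0, 1, 0], ![1, 2, 2, 0], ![0, 2, 0, 0], ![2, 0, 1, 2]] v.1 v.2)
    (L := slopeOne) (t := (1, [(0, 2), (3, 0)])) (by decide) (by decide) (by decide)
  have hb := IsLeadBasis.empty.insert hδ (by simp)
  rw [insert_empty_eq] at hb
  rw [minorZero_eq, minorOne_eq]
  exact hb.isRadical_span_insert_linear (2, 3) ha hc (by decide)
    (Set.singleton_subset_iff.2 (ofTerms_mem_supported K (by decide)))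
    (ofTerms_mem_supported K (by decide)) (ofTerms_mem_supported K (by decide))
    (ofTerms_mem_supported K (by decide)) (ofTerms_mem_supported K (by decide))
    (isRadical_span_resultants K)

theorem isRadical_span_minors [Field K] :
    (Ideal.span {ofTerms K slopeTwo * X (0, 1) + ofTerms K constTwo,
      ofTerms K slopeThree * X (0, 1) + ofTerms K constThree,
      ofTerms K minorZero, ofTerms K minorOne}).IsRadical := by
  obtain ⟨m⟩ := nonempty_monomialOrder (Fin 4 × Fin 4)
  have h0 := hasLead_ofTerms K m
    (fun v => ![![3, 0, 0, 2], ![0, 1, 1, 3], ![3, 0, 3, 4], ![0, 4, 4, 4]] v.1 v.2)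
    (L := minorZero) (t := (-1, [(1, 3), (2, 2), (3, 1)])) (by decide) (by decide) (by decide)
  have h1 := hasLead_ofTerms K m
    (fun v => ![![3, 0, 0, 2], ![0, 1, 1, 3], ![3, 0, 3, 4], ![0, 4, 4, 4]] v.1 v.2)
    (L := minorOne) (t := (-1, [(0, 0), (2, 3), (3, 2)])) (by decide) (by decide) (by decide)
  have ha := hasLead_ofTerms K m
    (fun v => ![![3, 0, 0, 2], ![0, 1, 1, 3], ![3, 0, 3, 4], ![0, 4, 4, 4]] v.1 v.2)
    (L := slopeTwo) (t := (-1, [(1, 0), (3, 3)])) (by decide) (by decide) (by decide)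
  have hc := hasLead_ofTerms K m
    (fun v => ![![3, 0, 0, 2], ![0, 1, 1, 3], ![3, 0, 3, 4], ![0, 4, 4, 4]] v.1 v.2)
    (L := slopeThree) (t := (1, [(1, 2), (2, 0)])) (by decide) (by decide) (by decide)
  have hb := (IsLeadBasis.empty.insert h1 (by simp)).insert h0 (by decide)
  rw [insert_empty_eq] at hb
  refine hb.isRadical_span_insert_linear (0, 1) ha hc (by decide)
    (Set.insert_subset (ofTerms_mem_supported K (by decide))
      (Set.singleton_subset_iff.2 (ofTerms_mem_supported K (by decide))))
    (ofTerms_mem_supported K (by decide)) (ofTerms_mem_supported K (by decide))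
    (ofTerms_mem_supported K (by decide)) (ofTerms_mem_supported K (by decide)) ?_
  rw [resultant_eq, Set.insert_comm, Set.pair_comm (ofTerms K resultant)]
  exact isRadical_span_minorZero_minorOne_resultant K

end PrincipalMinors

theorem prinMinorIdeal_eq_span_range_succAbove (K : Type*) [Field K] (n : ℕ) :
    prinMinorIdeal K (n + 1) n = Ideal.span (Set.range fun k : Fin (n + 1) =>
      ((genMat K (n + 1)).submatrix k.succAbove k.succAbove).det) := by
  have hdet : ∀ (k : Fin (n + 1)) (s : Finset (Fin (n + 1))), s = {k}ᶜ →
      ((genMat K (n + 1)).submatrix k.succAbove k.succAbove).det =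
        ((genMat K (n + 1)).submatrix (fun i : {x // x ∈ s} => (i : Fin (n + 1)))
          (fun j : {x // x ∈ s} => (j : Fin (n + 1)))).det := by
    rintro k s rfl
    let e : Fin n ≃ {x // x ∈ ({k}ᶜ : Finset (Fin (n + 1)))} :=
      (finSuccAboveEquiv k).trans (Equiv.subtypeEquivRight (by simp))
    rw [← Matrix.det_submatrix_equiv_self e]
    rfl
  refine congrArg Ideal.span (Set.ext fun p => ⟨?_, ?_⟩)
  · rintro ⟨s, hs, rfl⟩
    obtain ⟨k, hk⟩ := Finset.card_eq_one.1
      (show sᶜ.card = 1 by rw [Finset.card_compl, hs, Fintype.card_fin]; omega)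
    exact ⟨k, hdet k s (by rw [← hk, compl_compl])⟩
  · rintro ⟨k, rfl⟩
    exact ⟨{k}ᶜ, by simp [Finset.card_compl], hdet k _ rfl⟩

open MvPolynomial PrincipalMinors in
theorem range_det_submatrix_succAbove_genMat_four (K : Type*) [Field K] :
    (Set.range fun k : Fin 4 => ((genMat K 4).submatrix k.succAbove k.succAbove).det) =
      {ofTerms K slopeTwo * X (0, 1) + ofTerms K constTwo,
        ofTerms K slopeThree * X (0, 1) + ofTerms K constThree,
        ofTerms K minorZero, ofTerms K minorOne} := by
  have h0 : ((genMat K 4).submatrix (Fin.succAbove 0) (Fin.succAbove 0)).det =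
      ofTerms K minorZero := by
    rw [show Fin.succAbove (0 : Fin 4) = ![1, 2, 3] by decide, Matrix.det_fin_three]
    simp [genMat, ofTerms, minorZero]
    ring
  have h1 : ((genMat K 4).submatrix (Fin.succAbove 1) (Fin.succAbove 1)).det =
      ofTerms K minorOne := by
    rw [show Fin.succAbove (1 : Fin 4) = ![0, 2, 3] by decide, Matrix.det_fin_three]
    simp [genMat, ofTerms, minorOne]
    ring
  have h2 : ((genMat K 4).submatrix (Fin.succAbove 2) (Fin.succAbove 2)).det =
      ofTerms K slopeTwo * X (0, 1) + ofTerms K constTwo := by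
    rw [show Fin.succAbove (2 : Fin 4) = ![0, 1, 3] by decide, Matrix.det_fin_three]
    simp [genMat, ofTerms, slopeTwo, constTwo]
    ring
  have h3 : ((genMat K 4).submatrix (Fin.succAbove 3) (Fin.succAbove 3)).det =
      ofTerms K slopeThree * X (0, 1) + ofTerms K constThree := by
    rw [show Fin.succAbove (3 : Fin 4) = ![0, 1, 2] by decide, Matrix.det_fin_three]
    simp [genMat, ofTerms, slopeThree, constThree]
    ring
  refine Set.Subset.antisymm ?_ ?_
  · rintro _ ⟨k, rfl⟩
    fin_cases k
    exacts [Or.inr (Or.inr (Or.inl h0)), Or.inr (Or.inr (Or.inr h1)), Or.inl h2,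
      Or.inr (Or.inl h3)]
  · rintro p (rfl | rfl | rfl | rfl)
    exacts [⟨2, h2⟩, ⟨3, h3⟩, ⟨0, h0⟩, ⟨1, h1⟩]

/-- For `n = 4`, the ideal `P₃` generated by the four principal 3-minors of the
generic `4 × 4` matrix is a radical ideal of `S = K[X]`. -/
theorem prinMinorIdeal_three_isRadical (K : Type*) [Field K] [IsAlgClosed K] :
    (prinMinorIdeal K 4 3).IsRadical := by
  rw [prinMinorIdeal_eq_span_range_succAbove, range_det_submatrix_succAbove_genMat_four]
  exact PrincipalMinors.isRadical_span_minors K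
end

section
/- For n = 4, the ideal P_3 generated by the principal 3-minors of the generic 4×4 matrix equals the intersection I_3 ∩ Q_3 of the determinantal ideal I_3 with the contracted ideal Q_3. -/
open Matrix

section RegularMod

variable {R : Type*} [CommRing R]

/-- `f` is a nonzerodivisor modulo the ideal `J`. -/
def RegularMod (J : Ideal R) (f : R) : Prop := ∀ h, f * h ∈ J → h ∈ J

/-- Each entry of the list is a nonzerodivisor modulo `J` and the preceding entries. -/
def WeakRegular : Ideal R → List R → Prop
  | _, [] => True
  | J, f :: l => RegularMod J f ∧ WeakRegular (J ⊔ Ideal.span {f}) l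

/-- The ideal generated by `J` and the entries of the list. -/
def adjoinList : Ideal R → List R → Ideal R
  | J, [] => J
  | J, f :: l => adjoinList (J ⊔ Ideal.span {f}) l

theorem mem_sup_span_singleton {J : Ideal R} {f x : R} :
    x ∈ J ⊔ Ideal.span {f} ↔ ∃ c, x - f * c ∈ J := by
  rw [Submodule.mem_sup]
  constructor
  · rintro ⟨y, hy, z, hz, rfl⟩
    obtain ⟨c, rfl⟩ := Ideal.mem_span_singleton'.1 hz
    exact ⟨c, by convert hy using 1; ring⟩
  · rintro ⟨c, hc⟩
    exact ⟨_, hc, f * c, Ideal.mul_mem_right _ _ (Ideal.mem_span_singleton_self f), by ring⟩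

theorem RegularMod.swap {J : Ideal R} {f g : R} (hf : RegularMod J f)
    (hg : RegularMod (J ⊔ Ideal.span {f}) g) : RegularMod (J ⊔ Ideal.span {g}) f := by
  intro h hh
  obtain ⟨c, hc⟩ := mem_sup_span_singleton.1 hh
  have h1 : g * c ∈ J ⊔ Ideal.span {f} :=
    mem_sup_span_singleton.2 ⟨h, by convert J.neg_mem hc using 1; ring⟩
  obtain ⟨e, he⟩ := mem_sup_span_singleton.1 (hg c h1)
  refine mem_sup_span_singleton.2 ⟨e, hf _ ?_⟩
  convert J.add_mem hc (J.mul_mem_left g he) using 1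
  ring

theorem RegularMod.adjoinList {J : Ideal R} {f : R} {l : List R} (hf : RegularMod J f)
    (hl : WeakRegular (J ⊔ Ideal.span {f}) l) : RegularMod (adjoinList J l) f := by
  induction l generalizing J with
  | nil => exact hf
  | cons g l ih =>
    refine ih (hf.swap hl.1) ?_
    rw [sup_right_comm]
    exact hl.2

theorem weakRegular_append {J : Ideal R} {l₁ l₂ : List R} :
    WeakRegular J (l₁ ++ l₂) ↔ WeakRegular J l₁ ∧ WeakRegular (adjoinList J l₁) l₂ := by
  induction l₁ generalizing J with
  | nil => simp [WeakRegular, adjoinList]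
  | cons f l ih => simp [WeakRegular, adjoinList, ih, and_assoc]

theorem RegularMod.mul_right {J : Ideal R} {x g h : R} (hx : RegularMod J x)
    (hxh : RegularMod (J ⊔ Ideal.span {x}) h) (hgh : RegularMod (J ⊔ Ideal.span {g}) h) :
    RegularMod (J ⊔ Ideal.span {x * g}) h := by
  intro c hc
  obtain ⟨e, he⟩ := mem_sup_span_singleton.1 hc
  have h1 : h * c ∈ J ⊔ Ideal.span {x} :=
    mem_sup_span_singleton.2 ⟨g * e, by convert he using 1; ring⟩
  obtain ⟨a, ha⟩ := mem_sup_span_singleton.1 (hxh c h1)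
  have h2 : h * a - g * e ∈ J := by
    refine hx _ ?_
    convert J.sub_mem he (J.mul_mem_left h ha) using 1
    ring
  obtain ⟨b, hb⟩ := mem_sup_span_singleton.1 (hgh a (mem_sup_span_singleton.2 ⟨e, h2⟩))
  refine mem_sup_span_singleton.2 ⟨b, ?_⟩
  convert J.add_mem ha (J.mul_mem_left x hb) using 1
  ring

theorem WeakRegular.mul_cons {J : Ideal R} {x g : R} {l : List R}
    (hx : WeakRegular J (x :: l)) (hg : WeakRegular J (g :: l)) :
    WeakRegular J ((x * g) :: l) := by
  refine ⟨fun h hh => hg.1 _ (hx.1 _ (by rwa [← mul_assoc])), ?_⟩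
  induction l generalizing J with
  | nil => trivial
  | cons h l ih =>
    refine ⟨hx.1.mul_right hx.2.1 hg.2.1, ?_⟩
    rw [sup_right_comm]
    refine ih ⟨hx.1.swap hx.2.1, ?_⟩ ⟨hg.1.swap hg.2.1, ?_⟩
    · rw [sup_right_comm]; exact hx.2.2
    · rw [sup_right_comm]; exact hg.2.2

theorem RegularMod.congr {J : Ideal R} {f g : R} (h : f - g ∈ J) (hf : RegularMod J f) :
    RegularMod J g := fun x hx => hf x <| by
  convert J.add_mem (J.mul_mem_right x h) hx using 1
  ring

theorem RegularMod.pow {J : Ideal R} {f : R} (hf : RegularMod J f)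
    (n : ℕ) : RegularMod J (f ^ n) := by
  induction n with
  | zero => intro h hh; simpa using hh
  | succ n ih => exact fun h hh => hf _ (ih _ (by rwa [← mul_assoc, ← pow_succ]))

theorem sup_span_singleton_congr {J : Ideal R} {f g : R} (h : f - g ∈ J) :
    J ⊔ Ideal.span {f} = J ⊔ Ideal.span {g} := by
  ext x
  simp only [mem_sup_span_singleton]
  refine exists_congr fun c => ⟨fun hx => ?_, fun hx => ?_⟩
  · convert J.add_mem hx (J.mul_mem_right c h) using 1; ring
  · convert J.sub_mem hx (J.mul_mem_right c h) using 1; ring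

theorem WeakRegular.congr_map {ι : Type*} {J : Ideal R} {u v : ι → R} (h : ∀ i, u i - v i ∈ J)
    {l : List ι} (hl : WeakRegular J (l.map u)) : WeakRegular J (l.map v) := by
  induction l generalizing J with
  | nil => trivial
  | cons i l ih =>
    refine ⟨hl.1.congr (h i), ?_⟩
    rw [← sup_span_singleton_congr (h i)]
    exact ih (fun j => le_sup_left (a := J) (h j)) hl.2

end RegularMod

section Weight

open MvPolynomial

variable {σ K : Type*} [Field K] {w : σ → ℕ}

/-- All monomials of `p` have weight less than `n`. -/
def WeightLT (w : σ → ℕ) (n : ℕ) (p : MvPolynomial σ K) : Prop :=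
  ∀ m, n ≤ Finsupp.weight w m → coeff m p = 0

theorem WeightLT.mono {n k : ℕ} {p : MvPolynomial σ K} (hp : WeightLT w n p) (h : n ≤ k) :
    WeightLT w k p := fun m hm => hp m (h.trans hm)

theorem weightLT_zero_iff {p : MvPolynomial σ K} : WeightLT w 0 p ↔ p = 0 := by
  simp [WeightLT, MvPolynomial.ext_iff]

theorem WeightLT.add {n : ℕ} {p q : MvPolynomial σ K} (hp : WeightLT w n p)
    (hq : WeightLT w n q) : WeightLT w n (p + q) := fun m hm => by simp [hp m hm, hq m hm]

theorem WeightLT.sub {n : ℕ} {p q : MvPolynomial σ K} (hp : WeightLT w n p)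
    (hq : WeightLT w n q) : WeightLT w n (p - q) := fun m hm => by simp [hp m hm, hq m hm]

theorem WeightLT.component_eq_zero {n : ℕ} {p : MvPolynomial σ K} (hp : WeightLT w n p) :
    weightedHomogeneousComponent w n p = 0 := by
  classical
  ext m
  rw [coeff_weightedHomogeneousComponent]
  split_ifs with h
  · simpa using hp m h.ge
  · simp

theorem WeightLT.mul {a b : ℕ} {p q : MvPolynomial σ K} (hp : WeightLT w (a + 1) p)
    (hq : WeightLT w b q) : WeightLT w (a + b) (p * q) := by
  classical
  intro m hm
  rw [coeff_mul]
  refine Finset.sum_eq_zero fun x hx => ?_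
  rw [Finset.HasAntidiagonal.mem_antidiagonal] at hx
  rw [← hx, map_add] at hm
  by_cases h : a + 1 ≤ Finsupp.weight w x.1
  · rw [hp _ h, zero_mul]
  · rw [hq _ (by omega), mul_zero]

theorem MvPolynomial.IsWeightedHomogeneous.weightLT {n : ℕ} {p : MvPolynomial σ K}
    (hp : IsWeightedHomogeneous w p n) : WeightLT w (n + 1) p := fun m hm => by
  by_contra h
  have := hp h
  omega

theorem weightLT_component (n : ℕ) (p : MvPolynomial σ K) :
    WeightLT w (n + 1) (weightedHomogeneousComponent w n p) :=
  (weightedHomogeneousComponent_isWeightedHomogeneous n p).weightLT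

theorem component_component (n : ℕ) (p : MvPolynomial σ K) :
    weightedHomogeneousComponent w n (weightedHomogeneousComponent w n p) =
      weightedHomogeneousComponent w n p :=
  (weightedHomogeneousComponent_isWeightedHomogeneous n p).weightedHomogeneousComponent_same

theorem WeightLT.of_component {n : ℕ} {p : MvPolynomial σ K} (hp : WeightLT w (n + 1) p)
    (h : weightedHomogeneousComponent w n p = 0) : WeightLT w n p := by
  classical
  intro m hm
  rcases hm.eq_or_lt with e | l
  · simpa [coeff_weightedHomogeneousComponent, e.symm] using congrArg (coeff m) h
  · exact hp m l

theorem WeightLT.component_mul {a b : ℕ} {p q : MvPolynomial σ K} (hp : WeightLT w (a + 1) p)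
    (hq : WeightLT w (b + 1) q) : weightedHomogeneousComponent w (a + b) (p * q) =
      weightedHomogeneousComponent w a p * weightedHomogeneousComponent w b q := by
  set p₀ := weightedHomogeneousComponent w a p
  set q₀ := weightedHomogeneousComponent w b q
  have h1 : WeightLT w a (p - p₀) := (hp.sub (weightLT_component a p)).of_component <| by
    rw [map_sub, component_component, sub_self]
  have h2 : WeightLT w b (q - q₀) := (hq.sub (weightLT_component b q)).of_component <| by
    rw [map_sub, component_component, sub_self]
  have h3 := (hq.mul h1).component_eq_zero
  have h4 := ((weightLT_component a p).mul h2).component_eq_zero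
  have h5 : IsWeightedHomogeneous w (p₀ * q₀) (a + b) :=
    (weightedHomogeneousComponent_isWeightedHomogeneous a p).mul
      (weightedHomogeneousComponent_isWeightedHomogeneous b q)
  have h6 : p * q = q * (p - p₀) + p₀ * (q - q₀) + p₀ * q₀ := by ring
  rw [h6, map_add, map_add, h5.weightedHomogeneousComponent_same, add_comm a b, h3, add_comm b a,
    h4, zero_add, zero_add]

theorem component_mul_of_le {a n : ℕ} (h : a ≤ n) (p q : MvPolynomial σ K) :
    weightedHomogeneousComponent w n (weightedHomogeneousComponent w a p * q) =
      weightedHomogeneousComponent w a p * weightedHomogeneousComponent w (n - a) q := by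
  classical
  induction q using MvPolynomial.induction_on' with
  | add q₁ q₂ h₁ h₂ => simp only [mul_add, map_add, h₁, h₂]
  | monomial m c =>
    have hm := isWeightedHomogeneous_monomial w m c rfl
    have hp := weightedHomogeneousComponent_isWeightedHomogeneous (w := w) a p
    by_cases e : n = a + Finsupp.weight w m
    · subst e
      rw [(hp.mul hm).weightedHomogeneousComponent_same, Nat.add_sub_cancel_left,
        hm.weightedHomogeneousComponent_same]
    · rw [(hp.mul hm).weightedHomogeneousComponent_ne _ e,
        hm.weightedHomogeneousComponent_ne _ (by omega), mul_zero]

theorem component_mul_of_lt {a n : ℕ} (h : n < a) (p q : MvPolynomial σ K) :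
    weightedHomogeneousComponent w n (weightedHomogeneousComponent w a p * q) = 0 := by
  classical
  induction q using MvPolynomial.induction_on' with
  | add q₁ q₂ h₁ h₂ => simp only [mul_add, map_add, h₁, h₂, add_zero]
  | monomial m c =>
    have hm := isWeightedHomogeneous_monomial w m c rfl
    have hp := weightedHomogeneousComponent_isWeightedHomogeneous (w := w) a p
    rw [(hp.mul hm).weightedHomogeneousComponent_ne _ (by omega)]

/-- `G` is the ideal of leading forms of the elements of `J` for the weight `w`. -/
structure IsInitialIdeal (w : σ → ℕ) (J G : Ideal (MvPolynomial σ K)) : Prop where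
  component_mem : ∀ n, ∀ p ∈ J, WeightLT w (n + 1) p → weightedHomogeneousComponent w n p ∈ G
  exists_lift : ∀ n, ∀ q ∈ G, ∃ p ∈ J, WeightLT w (n + 1) p ∧
    weightedHomogeneousComponent w n p = weightedHomogeneousComponent w n q

namespace IsInitialIdeal

variable {J G : Ideal (MvPolynomial σ K)}

theorem bot : IsInitialIdeal w (⊥ : Ideal (MvPolynomial σ K)) ⊥ where
  component_mem n p hp _ := by simp [(Submodule.mem_bot _).1 hp]
  exists_lift n q hq := ⟨0, by simp, by simp [WeightLT], by simp [(Submodule.mem_bot _).1 hq]⟩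

/-- Subtracting an element of `J` lowers the weight of a polynomial with leading form in `G`. -/
theorem exists_sub (H : IsInitialIdeal w J G) {n : ℕ} {h : MvPolynomial σ K}
    (hh : WeightLT w (n + 1) h) (hG : weightedHomogeneousComponent w n h ∈ G) :
    ∃ p ∈ J, WeightLT w n (h - p) := by
  obtain ⟨p, hpJ, hp, e⟩ := H.exists_lift n _ hG
  refine ⟨p, hpJ, (hh.sub hp).of_component ?_⟩
  rw [map_sub, e, component_component, sub_self]

theorem regularMod (H : IsInitialIdeal w J G) {d : ℕ} {f : MvPolynomial σ K}
    (hf : WeightLT w (d + 1) f) (hg : RegularMod G (weightedHomogeneousComponent w d f)) :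
    RegularMod J f := by
  suffices ∀ n h, WeightLT w n h → f * h ∈ J → h ∈ J by
    intro h hh
    refine this (weightedTotalDegree w h + 1) h (fun m hm => ?_) hh
    by_contra hc
    have := le_weightedTotalDegree w (mem_support_iff.2 hc)
    omega
  intro n
  induction n with
  | zero => intro h hh _; simp [weightLT_zero_iff.1 hh]
  | succ n ih =>
    intro h hh hJ
    have h1 := H.component_mem (d + n) _ hJ (hf.mul hh)
    rw [hf.component_mul hh] at h1
    obtain ⟨p, hpJ, hp⟩ := H.exists_sub hh (hg _ h1)
    have := ih (h - p) hp (by rw [mul_sub]; exact J.sub_mem hJ (J.mul_mem_left _ hpJ))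
    simpa using J.add_mem this hpJ

theorem sup (H : IsInitialIdeal w J G) {d : ℕ} {f : MvPolynomial σ K}
    (hf : WeightLT w (d + 1) f) (hg : RegularMod G (weightedHomogeneousComponent w d f)) :
    IsInitialIdeal w (J ⊔ Ideal.span {f})
      (G ⊔ Ideal.span {weightedHomogeneousComponent w d f}) where
  component_mem n p hp hn := by
    obtain ⟨h, hh⟩ := mem_sup_span_singleton.1 hp
    obtain ⟨N, hN⟩ : ∃ N, WeightLT w N h := ⟨weightedTotalDegree w h + 1, fun m hm => by
      by_contra hc
      have := le_weightedTotalDegree w (mem_support_iff.2 hc)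
      omega⟩
    clear hp
    induction N generalizing h with
    | zero =>
      rw [weightLT_zero_iff.1 hN, mul_zero, sub_zero] at hh
      exact le_sup_left (a := G) (H.component_mem n p hh hn)
    | succ N ih =>
      rcases le_or_gt (d + N) n with hle | hlt
      · have h1 : WeightLT w (n - d + 1) h := hN.mono (by omega)
        have h2 := hf.mul h1
        have h3 := hf.component_mul h1
        rw [Nat.add_sub_cancel' (by omega)] at h3
        rw [show d + (n - d + 1) = n + 1 by omega] at h2
        refine mem_sup_span_singleton.2 ⟨weightedHomogeneousComponent w (n - d) h, ?_⟩
        rw [← h3, ← map_sub]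
        exact H.component_mem n _ hh (hn.sub h2)
      · have h1 := H.component_mem (d + N) _ hh ((hn.mono (by omega)).sub (hf.mul hN))
        rw [map_sub, (hn.mono hlt).component_eq_zero, zero_sub, hf.component_mul hN,
          Ideal.neg_mem_iff] at h1
        obtain ⟨q, hqJ, hq⟩ := H.exists_sub hN (hg _ h1)
        refine ih (h - q) ?_ hq
        convert J.add_mem hh (J.mul_mem_left f hqJ) using 1
        ring
  exists_lift n q hq := by
    obtain ⟨e, he⟩ := mem_sup_span_singleton.1 hq
    obtain ⟨p, hpJ, hp, hpe⟩ := H.exists_lift n _ he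
    rw [map_sub] at hpe
    rcases le_or_gt d n with h | h
    · have h1 := weightLT_component (w := w) (n - d) e
      have h2 := hf.mul h1
      have h3 := hf.component_mul h1
      rw [Nat.add_sub_cancel' h, component_component] at h3
      rw [show d + (n - d + 1) = n + 1 by omega] at h2
      refine ⟨p + f * weightedHomogeneousComponent w (n - d) e, ?_, hp.add h2, ?_⟩
      · exact mem_sup_span_singleton.2 ⟨weightedHomogeneousComponent w (n - d) e, by simpa using hpJ⟩
      · rw [map_add, hpe, h3, component_mul_of_le h, sub_add_cancel]
    · rw [component_mul_of_lt h, sub_zero] at hpe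
      exact ⟨p, le_sup_left (a := J) hpJ, hp, hpe⟩

theorem weakRegular {ι : Type*} (H : IsInitialIdeal w J G) (u : ι → MvPolynomial σ K) (d : ι → ℕ)
    (hu : ∀ i, WeightLT w (d i + 1) (u i)) (l : List ι)
    (hl : WeakRegular G (l.map fun i => weightedHomogeneousComponent w (d i) (u i))) :
    WeakRegular J (l.map u) := by
  induction l generalizing J G with
  | nil => trivial
  | cons i l ih => exact ⟨H.regularMod (hu i) hl.1, ih (H.sup (hu i) hl.1) hl.2⟩

end IsInitialIdeal

end Weight

section Certificate

open MvPolynomial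

variable {σ : Type*}

/-- A polynomial with integer coefficients, as a list of coefficients and lists of variables. -/
abbrev SparsePoly (σ : Type*) := List (ℤ × List σ)

/-- The exponent of the monomial that is the product of a list of variables. -/
noncomputable def exponent (m : List σ) : σ →₀ ℕ := (m.map fun v => Finsupp.single v 1).sum

/-- The polynomial encoded by a sparse polynomial. -/
noncomputable def SparsePoly.toPoly (K : Type*) [Field K] (f : SparsePoly σ) :
    MvPolynomial σ K :=
  (f.map fun t => monomial (exponent t.2) (t.1 : K)).sum

/-- A recipe proving that a list of polynomials is weakly regular: the entries are monomials
in disjoint sets of variables, or one passes to leading forms for the weight counting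
multiplicities in a list of variables, or one splits a variable off the `i`-th entry. -/
inductive RegularityCert (σ : Type*)
  | leaf : RegularityCert σ
  | weight (w : List σ) (c : RegularityCert σ) : RegularityCert σ
  | factor (i : ℕ) (v : σ) (c₁ c₂ : RegularityCert σ) : RegularityCert σ

section

variable [DecidableEq σ]

/-- The weight of a product of variables. -/
def listWeight (w m : List σ) : ℕ := (m.map fun v => w.count v).sum

/-- The largest weight of a term. -/
def SparsePoly.weightedDegree (w : List σ) (f : SparsePoly σ) : ℕ :=
  f.foldr (fun t n => max (listWeight w t.2) n) 0

/-- The leading form. -/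
def SparsePoly.leadingForm (w : List σ) (f : SparsePoly σ) : SparsePoly σ :=
  f.filter fun t => listWeight w t.2 = f.weightedDegree w

/-- Substitute zero for a variable. -/
def SparsePoly.kill (v : σ) (f : SparsePoly σ) : SparsePoly σ := f.filter fun t => v ∉ t.2

/-- Divide by a variable that occurs in all terms. -/
def SparsePoly.divVar (v : σ) (f : SparsePoly σ) : SparsePoly σ :=
  f.map fun t => (t.1, t.2.erase v)

/-- The entries are monomials in disjoint sets of variables. -/
def isDisjointMonomials : List (SparsePoly σ) → Bool
  | [] => true
  | [(c, m)] :: l => (c = 1 ∨ c = -1) && (l.all fun f => f.all fun t => m.all fun v => v ∉ t.2) &&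
      isDisjointMonomials l
  | _ => false

/-- Check a regularity certificate. -/
def RegularityCert.check : RegularityCert σ → List (SparsePoly σ) → Bool
  | leaf, F => isDisjointMonomials F
  | weight w c, F => c.check (F.map fun f => f.leadingForm w)
  | factor i v c₁ c₂, F =>
    match F.drop i with
    | [] => false
    | f :: l => (f.all fun t => v ∈ t.2) &&
        c₁.check (F.take i ++ [(1, [v])] :: l.map fun f => f.kill v) &&
        c₂.check (F.take i ++ f.divVar v :: l)

end

variable {K : Type*} [Field K]

theorem exponent_nil : exponent ([] : List σ) = 0 := rfl

theorem exponent_cons (v : σ) (m : List σ) :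
    exponent (v :: m) = Finsupp.single v 1 + exponent m := by simp [exponent]

@[simp] theorem SparsePoly.toPoly_nil : SparsePoly.toPoly K ([] : SparsePoly σ) = 0 := rfl

@[simp] theorem SparsePoly.toPoly_cons (t : ℤ × List σ) (f : SparsePoly σ) :
    SparsePoly.toPoly K (t :: f) =
      monomial (exponent t.2) (t.1 : K) + SparsePoly.toPoly K f := by
  simp [SparsePoly.toPoly]

theorem monomial_exponent (m : List σ) (c : K) :
    monomial (exponent m) c = C c * (m.map X).prod := by
  induction m with
  | nil => simp [exponent_nil]
  | cons v m ih =>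
    rw [exponent_cons, add_comm, monomial_add_single, ih, List.map_cons, List.prod_cons, pow_one]
    ring

theorem exponent_eq_zero {v : σ} {m : List σ} (h : v ∉ m) : exponent m v = 0 := by
  classical
  induction m with
  | nil => simp [exponent_nil]
  | cons u m ih =>
    rw [List.mem_cons, not_or] at h
    simp [exponent_cons, ih h.2, Ne.symm h.1]

theorem span_monomial_sup_span {s : Set (σ →₀ ℕ)} {e : σ →₀ ℕ} {c : K} (hc : c ≠ 0) :
    Ideal.span ((fun e => monomial e (1 : K)) '' s) ⊔ Ideal.span {monomial e c} =
      Ideal.span ((fun e => monomial e (1 : K)) '' (insert e s)) := by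
  rw [Set.image_insert_eq, Ideal.span_insert, sup_comm]
  congr 1
  have : monomial e c = monomial e (1 : K) * C c := by simp [mul_comm, C_mul_monomial]
  rw [this, Ideal.span_singleton_mul_right_unit ((isUnit_iff_ne_zero.2 hc).map C)]

theorem regularMod_monomial {s : Set (σ →₀ ℕ)} {m : List σ} {c : K} (hc : c ≠ 0)
    (hs : ∀ e ∈ s, ∀ v ∈ m, e v = 0) :
    RegularMod (Ideal.span ((fun e => monomial e (1 : K)) '' s)) (monomial (exponent m) c) := by
  intro h hh
  rw [mem_ideal_span_monomial_image] at hh ⊢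
  intro x hx
  obtain ⟨e, he, hle⟩ := hh (exponent m + x) (by
    rw [mem_support_iff, coeff_monomial_mul]
    exact mul_ne_zero hc (mem_support_iff.1 hx))
  refine ⟨e, he, fun v => ?_⟩
  by_cases hv : v ∈ m
  · simp [hs e he v hv]
  · simpa [exponent_eq_zero hv] using hle v

variable [DecidableEq σ]

theorem weakRegular_of_isDisjointMonomials {F : List (SparsePoly σ)}
    (hF : isDisjointMonomials F) {s : Set (σ →₀ ℕ)}
    (hs : ∀ e ∈ s, ∀ f ∈ F, ∀ t ∈ f, ∀ v ∈ t.2, e v = 0) :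
    WeakRegular (Ideal.span ((fun e => monomial e (1 : K)) '' s))
      (F.map fun f => f.toPoly K) := by
  induction F generalizing s with
  | nil => trivial
  | cons f l ih =>
    match f with
    | [] => simp [isDisjointMonomials] at hF
    | _ :: _ :: _ => simp [isDisjointMonomials] at hF
    | [(c, m)] =>
      simp only [isDisjointMonomials, Bool.and_eq_true, decide_eq_true_eq, List.all_eq_true] at hF
      have hc : (c : K) ≠ 0 := by rcases hF.1.1 with rfl | rfl <;> simp
      simp only [List.map_cons, SparsePoly.toPoly_cons, SparsePoly.toPoly_nil, add_zero]
      refine ⟨regularMod_monomial hc fun e he v hv =>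
        hs e he [(c, m)] (by simp) (c, m) (by simp) v hv, ?_⟩
      rw [span_monomial_sup_span hc]
      refine ih hF.2 ?_
      rintro e (rfl | he) f hf t ht v hv
      · exact exponent_eq_zero fun h => hF.1.2 f hf t ht v h hv
      · exact hs e he f (by simp [hf]) t ht v hv

theorem weight_exponent (w m : List σ) :
    Finsupp.weight (fun v => w.count v) (exponent m) = listWeight w m := by
  induction m with
  | nil => simp [exponent_nil, listWeight]
  | cons v m ih =>
    rw [exponent_cons, map_add, ih, Finsupp.weight_single]
    simp [listWeight]

theorem component_toPoly (w : List σ) (n : ℕ) (f : SparsePoly σ) :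
    weightedHomogeneousComponent (fun v => w.count v) n (f.toPoly K) =
      SparsePoly.toPoly K (f.filter fun t => listWeight w t.2 = n) := by
  induction f with
  | nil => simp
  | cons t f ih =>
    have ht := isWeightedHomogeneous_monomial (fun v => w.count v) (exponent t.2) (t.1 : K)
      (weight_exponent w t.2)
    rw [SparsePoly.toPoly_cons, map_add, ih, List.filter_cons]
    by_cases h : listWeight w t.2 = n
    · rw [if_pos (by simpa using h), SparsePoly.toPoly_cons,
        ← h, ht.weightedHomogeneousComponent_same]
    · rw [if_neg (by simpa using h), ht.weightedHomogeneousComponent_ne _ (Ne.symm h), zero_add]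

theorem weightLT_toPoly (w : List σ) (n : ℕ) (f : SparsePoly σ) (h : f.weightedDegree w ≤ n) :
    WeightLT (fun v => w.count v) (n + 1) (f.toPoly K) := by
  induction f with
  | nil => simp [WeightLT]
  | cons t f ih =>
    rw [SparsePoly.weightedDegree, List.foldr_cons, max_le_iff] at h
    rw [SparsePoly.toPoly_cons]
    exact ((isWeightedHomogeneous_monomial _ _ _ (weight_exponent w t.2)).weightLT.mono
      (by omega)).add (ih h.2)

theorem toPoly_sub_kill_mem (v : σ) (f : SparsePoly σ) :
    f.toPoly K - (f.kill v).toPoly K ∈ Ideal.span {(X v : MvPolynomial σ K)} := by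
  induction f with
  | nil => simp [SparsePoly.kill]
  | cons t f ih =>
    rw [SparsePoly.kill, List.filter_cons, SparsePoly.toPoly_cons]
    split_ifs with h
    · rw [SparsePoly.toPoly_cons, add_sub_add_left_eq_sub]
      exact ih
    · rw [add_sub_assoc]
      refine Ideal.add_mem _ ?_ ih
      rw [monomial_exponent, Ideal.mem_span_singleton]
      exact Dvd.dvd.mul_left (List.dvd_prod (List.mem_map_of_mem (by simpa using h))) _

theorem toPoly_eq_X_mul (v : σ) (f : SparsePoly σ) (h : ∀ t ∈ f, v ∈ t.2) :
    f.toPoly K = X v * (f.divVar v).toPoly K := by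
  induction f with
  | nil => simp [SparsePoly.divVar]
  | cons t f ih =>
    have h1 := List.prod_map_erase (X : σ → MvPolynomial σ K) (h t (by simp))
    rw [SparsePoly.divVar, List.map_cons, SparsePoly.toPoly_cons, SparsePoly.toPoly_cons,
      ih fun t ht => h t (by simp [ht]), SparsePoly.divVar, monomial_exponent, monomial_exponent,
      ← h1]
    ring

theorem RegularityCert.weakRegular (c : RegularityCert σ) (F : List (SparsePoly σ))
    (h : c.check F) :
    WeakRegular (⊥ : Ideal (MvPolynomial σ K)) (F.map fun f => f.toPoly K) := by
  induction c generalizing F with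
  | leaf => simpa using weakRegular_of_isDisjointMonomials (K := K) h (s := ∅) (by simp)
  | weight w c ih =>
    refine IsInitialIdeal.bot.weakRegular (w := fun v => w.count v) _
      (fun f => f.weightedDegree w) (fun f => weightLT_toPoly w _ f le_rfl) _ ?_
    simp only [component_toPoly]
    have h1 := ih _ h
    rw [List.map_map] at h1
    exact h1
  | factor i v c₁ c₂ ih₁ ih₂ =>
    rw [check] at h
    split at h
    · simp at h
    · rename_i f l hF
      simp only [Bool.and_eq_true, List.all_eq_true, decide_eq_true_eq] at h
      have h1 := ih₁ _ h.1.2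
      have h2 := ih₂ _ h.2
      rw [← List.take_append_drop i F, hF, List.map_append, List.map_cons,
        toPoly_eq_X_mul v f h.1.1]
      rw [List.map_append, List.map_cons, weakRegular_append] at h1 h2
      refine weakRegular_append.2 ⟨h1.1, .mul_cons ?_ h2.2⟩
      have h3 := h1.2
      simp only [SparsePoly.toPoly_cons, SparsePoly.toPoly_nil, monomial_exponent,
        List.map_map] at h3
      simp only [Int.cast_one, map_one, List.map_cons, List.map_nil, List.prod_cons,
        List.prod_nil, mul_one, one_mul, add_zero] at h3
      refine ⟨h3.1, h3.2.congr_map fun f => ?_⟩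
      rw [← neg_sub, Ideal.neg_mem_iff]
      exact Ideal.mem_sup_right (toPoly_sub_kill_mem v f)

end Certificate

section Regularity

/-- The variables of the polynomial ring on the entries of the generic `4 × 4` matrix. -/
abbrev Entry := Fin 4 × Fin 4

/-- The leading principal `2`-minor. -/
def sparseMinorTwo : SparsePoly Entry := [(1, [(0, 0), (1, 1)]), (-1, [(0, 1), (1, 0)])]

/-- The principal `3`-minor on rows and columns `a, b, c`. -/
def sparseMinorThree (a b c : Fin 4) : SparsePoly Entry :=
  [(1, [(a, a), (b, b), (c, c)]), (1, [(a, b), (b, c), (c, a)]), (1, [(a, c), (b, a), (c, b)]),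
    (-1, [(a, a), (b, c), (c, b)]), (-1, [(a, b), (b, a), (c, c)]), (-1, [(a, c), (b, b), (c, a)])]

/-- A certificate that the leading principal `2`-minor and the four principal `3`-minors form
a weakly regular sequence. -/
def minorsCert : RegularityCert Entry :=
  .weight [(0, 2), (0, 3), (1, 2), (3, 0), (3, 2)]
    (.factor 3 (0, 3)
      (.weight [(0, 0), (0, 1)]
        (.factor 4 (1, 2)
          (.weight [(0, 0), (0, 1), (0, 1), (2, 1), (2, 1), (2, 3), (3, 0), (3, 0), (3, 1),
              (3, 2), (3, 2)]
            .leaf)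
          (.weight [(0, 0), (0, 0), (0, 1), (0, 1), (0, 1), (0, 2), (0, 2), (0, 2), (1, 1),
              (1, 1), (1, 3), (2, 0), (3, 0), (3, 0), (3, 3), (3, 3), (3, 3)]
            .leaf)))
      (.factor 3 (1, 1)
        (.weight [(0, 0), (0, 1), (0, 2), (1, 2), (1, 3), (2, 2), (3, 0)]
          (.factor 4 (1, 2)
            (.weight [(0, 1), (0, 3), (0, 3), (1, 2), (1, 2), (1, 3), (1, 3), (2, 0), (3, 2)]
              .leaf)
            (.weight [(0, 0), (0, 0), (0, 0), (0, 1), (0, 1), (0, 1), (0, 2), (0, 3), (0, 3),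
                (1, 0), (1, 0), (1, 2), (1, 2), (1, 3), (1, 3), (2, 1), (2, 2), (2, 3), (3, 1),
                (3, 1), (3, 1), (3, 2), (3, 2)]
              .leaf)))
        (.weight [(0, 3), (0, 3), (3, 1), (3, 1), (3, 1), (3, 3)]
          (.factor 1 (1, 2)
            (.weight [(0, 0), (0, 0), (0, 0), (0, 2), (0, 2), (0, 3), (0, 3), (1, 0), (1, 0),
                (1, 0), (1, 1), (1, 1), (1, 1), (1, 2), (1, 2), (1, 3), (2, 0), (2, 1), (2, 1),
                (2, 1), (2, 3), (2, 3), (3, 0), (3, 2), (3, 2), (3, 2), (3, 3)]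
              .leaf)
            (.weight [(0, 0), (1, 0), (1, 0), (1, 1), (1, 1), (2, 1), (2, 2), (2, 3), (3, 2),
                (3, 2), (3, 3), (3, 3)]
              .leaf)))))

theorem minorsCert_check : minorsCert.check
    [sparseMinorTwo, sparseMinorThree 1 2 3, sparseMinorThree 0 2 3, sparseMinorThree 0 1 3,
      sparseMinorThree 0 1 2] = true := by
  decide +kernel

end Regularity

section SpanPair

variable {R : Type*} [CommRing R]

theorem WeakRegular.exists_eq_mul {x y : R} {l : List R} (H : WeakRegular ⊥ (x :: y :: l))
    {a b : R} (h : y * a = x * b) : ∃ z, a = x * z := by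
  obtain ⟨z, hz⟩ := mem_sup_span_singleton.1
    (H.2.1 a (mem_sup_span_singleton.2 ⟨b, by simp [h]⟩))
  exact ⟨z, by simpa [sub_eq_zero] using hz⟩

theorem WeakRegular.exists_eq_add {x y z : R} {l : List R}
    (H : WeakRegular ⊥ (x :: y :: z :: l)) {a b c : R} (h : z * a + y * b = x * c) :
    ∃ u v, a = x * u + y * v := by
  obtain ⟨v, hv⟩ := mem_sup_span_singleton.1 (H.2.2.1 a (mem_sup_span_singleton.2
    ⟨-b, mem_sup_span_singleton.2 ⟨c, by simp [← h]⟩⟩))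
  obtain ⟨u, hu⟩ := mem_sup_span_singleton.1 hv
  refine ⟨u, v, ?_⟩
  rw [Submodule.mem_bot] at hu
  linear_combination hu

theorem WeakRegular.exists_syzygy {x y z : R} (H : WeakRegular ⊥ [x, y, z]) {a b c : R}
    (h : z * a + y * b = x * c) : ∃ u v t, a = x * u + y * t ∧ b = x * v - z * t := by
  obtain ⟨u, t, rfl⟩ := H.exists_eq_add h
  obtain ⟨v, hv⟩ := H.exists_eq_mul (a := b + z * t) (b := c - z * u) (by linear_combination h)
  exact ⟨u, v, t, rfl, by linear_combination hv⟩

theorem WeakRegular.left_cancel {x a b : R} {l : List R} (H : WeakRegular ⊥ (x :: l))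
    (h : x * a = x * b) : a = b := by
  have := H.1 (a - b) (by rw [Submodule.mem_bot, mul_sub, h, sub_self])
  exact sub_eq_zero.1 this

/-- The ideal of `e * p * q + α * p + β * q` and `e' * p * q + γ * p + ε * q`, intersected with
`(p, q)`, is saturated with respect to `p * q`. -/
theorem mem_span_pair_of_mul_mem {p q e e' α β γ ε : R}
    (hpq : WeakRegular ⊥ [p, q, α * ε - β * γ]) (hp : WeakRegular ⊥ [p, ε, β])
    (hq : WeakRegular ⊥ [q, γ, α]) {F : R} (hF : F ∈ Ideal.span {p, q})
    (h : p * q * F ∈ Ideal.span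
      {e * p * q + α * p + β * q, e' * p * q + γ * p + ε * q}) :
    F ∈ Ideal.span {e * p * q + α * p + β * q, e' * p * q + γ * p + ε * q} := by
  obtain ⟨a, b, hab⟩ := Ideal.mem_span_pair.1 h
  obtain ⟨f₁, f₂, hf⟩ := Ideal.mem_span_pair.1 hF
  obtain ⟨z, hz⟩ := hpq.exists_eq_mul (a := β * a + ε * b)
    (b := q * F - e * a * q - a * α - e' * b * q - b * γ) (by linear_combination hab)
  obtain ⟨a', b', c, rfl, rfl⟩ := hp.exists_syzygy hz
  have h1 : q * F = c * (α * ε - β * γ + q * (e * ε - e' * β)) +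
      a' * (e * p * q + α * p + β * q) + b' * (e' * p * q + γ * p + ε * q) :=
    hp.left_cancel (by linear_combination -hab)
  have hqp : WeakRegular ⊥ [q, p, α * ε - β * γ] := by
    refine ⟨hq.1, hpq.1.swap hpq.2.1, ?_⟩
    rw [sup_right_comm]
    exact hpq.2.2
  obtain ⟨c₂, c₁, rfl⟩ := hqp.exists_eq_add (a := c) (b := a' * α + b' * γ)
    (c := F - c * (e * ε - e' * β) - a' * (e * p + β) - b' * (e' * p + ε))
    (by linear_combination -h1)
  obtain ⟨z', hz'⟩ := hqp.exists_eq_mul (a := α * (a' + c₁ * ε) + γ * (b' - c₁ * β))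
    (b := F - c₂ * (α * ε - β * γ + q * (e * ε - e' * β)) - (a' + c₁ * ε) * (e * p + β)
      - (b' - c₁ * β) * (e' * p + ε)) (by linear_combination -h1)
  obtain ⟨a₃, b₃, k, h3, h4⟩ := hq.exists_syzygy hz'
  have h2 : F = c₂ * (α * ε - β * γ + q * (e * ε - e' * β)) -
      k * (α * ε - β * γ + p * (α * e' - γ * e)) +
      a₃ * (e * p * q + α * p + β * q) + b₃ * (e' * p * q + γ * p + ε * q) := by
    refine hq.left_cancel ?_
    linear_combination h1 + (e * p * q + α * p + β * q) * h3 +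
      (e' * p * q + γ * p + ε * q) * h4
  obtain ⟨s, t, hst⟩ := hpq.exists_eq_add (a := c₂ - k)
    (b := -f₂ + c₂ * (e * ε - e' * β) + a₃ * (e * p + β) + b₃ * (e' * p + ε))
    (c := f₁ + k * (α * e' - γ * e) - a₃ * α - b₃ * γ)
    (by linear_combination -h2 - hf)
  refine Ideal.mem_span_pair.2 ⟨a₃ - k * e' + s * ε - t * γ - t * q * e',
    b₃ + k * e - s * β + t * α + t * q * e, ?_⟩
  linear_combination -h2 - (α * ε - β * γ + q * (e * ε - e' * β)) * hst

end SpanPair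

section Schur

open MvPolynomial

variable {R : Type*} [CommRing R]

/-- The principal `3`-minor on rows and columns `a, b, c`. -/
def minorThree (M : Matrix (Fin 4) (Fin 4) R) (a b c : Fin 4) : R :=
  (M.submatrix ![a, b, c] ![a, b, c]).det

/-- The leading principal `2`-minor of a matrix given by its entries. -/
def leadMinor (f : Entry → R) : R := f (0, 0) * f (1, 1) - f (0, 1) * f (1, 0)

/-- The matrix with leading `2 × 2` block `D`, upper right block `D * V` and lower left block
`U * D`, whose Schur complement is `det D` times a matrix with zero diagonal. -/
def schurMat (f : Entry → R) : Matrix (Fin 4) (Fin 4) R :=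
  !![f (0, 0), f (0, 1), f (0, 0) * f (0, 2) + f (0, 1) * f (1, 2),
      f (0, 0) * f (0, 3) + f (0, 1) * f (1, 3);
    f (1, 0), f (1, 1), f (1, 0) * f (0, 2) + f (1, 1) * f (1, 2),
      f (1, 0) * f (0, 3) + f (1, 1) * f (1, 3);
    f (2, 0) * f (0, 0) + f (2, 1) * f (1, 0), f (2, 0) * f (0, 1) + f (2, 1) * f (1, 1),
      f (2, 0) * (f (0, 0) * f (0, 2) + f (0, 1) * f (1, 2)) +
        f (2, 1) * (f (1, 0) * f (0, 2) + f (1, 1) * f (1, 2)),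
      leadMinor f * f (2, 3) + f (2, 0) * (f (0, 0) * f (0, 3) + f (0, 1) * f (1, 3)) +
        f (2, 1) * (f (1, 0) * f (0, 3) + f (1, 1) * f (1, 3));
    f (3, 0) * f (0, 0) + f (3, 1) * f (1, 0), f (3, 0) * f (0, 1) + f (3, 1) * f (1, 1),
      leadMinor f * f (3, 2) + f (3, 0) * (f (0, 0) * f (0, 2) + f (0, 1) * f (1, 2)) +
        f (3, 1) * (f (1, 0) * f (0, 2) + f (1, 1) * f (1, 2)),
      f (3, 0) * (f (0, 0) * f (0, 3) + f (0, 1) * f (1, 3)) +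
        f (3, 1) * (f (1, 0) * f (0, 3) + f (1, 1) * f (1, 3))]

/-- Up to a square, the principal minor of `schurMat f` obtained by deleting the first row
and column. -/
def reducedMinorZero (f : Entry → R) : R :=
  f (1, 1) * f (2, 3) * f (3, 2) + f (3, 0) * f (0, 2) * f (2, 3) + f (2, 0) * f (0, 3) * f (3, 2)

/-- Up to a square, the principal minor of `schurMat f` obtained by deleting the second row
and column. -/
def reducedMinorOne (f : Entry → R) : R :=
  f (0, 0) * f (2, 3) * f (3, 2) + f (3, 1) * f (1, 2) * f (2, 3) + f (2, 1) * f (1, 3) * f (3, 2)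

theorem minorThree_eq (M : Matrix (Fin 4) (Fin 4) R) (a b c : Fin 4) :
    minorThree M a b c = M a a * M b b * M c c - M a a * M b c * M c b - M a b * M b a * M c c +
      M a b * M b c * M c a + M a c * M b a * M c b - M a c * M b b * M c a := by
  rw [minorThree, det_fin_three]
  rfl

theorem map_minorThree {R' : Type*} [CommRing R'] (φ : R →+* R') (M : Matrix (Fin 4) (Fin 4) R)
    (a b c : Fin 4) : φ (minorThree M a b c) = minorThree (M.map φ) a b c := by
  simp [minorThree_eq]

theorem schurMat_map {R' : Type*} [CommRing R'] (φ : R →+* R') (f : Entry → R) :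
    (schurMat f).map φ = schurMat (φ ∘ f) := by
  ext i j
  fin_cases i <;> fin_cases j <;> simp [schurMat, leadMinor]

theorem minorThree_schurMat_one_two_three (f : Entry → R) :
    minorThree (schurMat f) 1 2 3 = -(leadMinor f ^ 2 * reducedMinorZero f) := by
  rw [minorThree_eq]
  simp [schurMat, leadMinor, reducedMinorZero]
  ring

theorem minorThree_schurMat_zero_two_three (f : Entry → R) :
    minorThree (schurMat f) 0 2 3 = -(leadMinor f ^ 2 * reducedMinorOne f) := by
  rw [minorThree_eq]
  simp [schurMat, leadMinor, reducedMinorOne]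
  ring

theorem minorThree_schurMat_zero_one_three (f : Entry → R) :
    minorThree (schurMat f) 0 1 3 = 0 := by
  rw [minorThree_eq]
  simp [schurMat]
  ring

theorem minorThree_schurMat_zero_one_two (f : Entry → R) :
    minorThree (schurMat f) 0 1 2 = 0 := by
  rw [minorThree_eq]
  simp [schurMat]
  ring

theorem det_schurMat (f : Entry → R) :
    (schurMat f).det = -(leadMinor f ^ 3 * (f (2, 3) * f (3, 2))) := by
  simp [schurMat, leadMinor, det_succ_row_zero, Fin.sum_univ_succ, Fin.succAbove]
  ring

/-- If `f` vanishes at `(2, 3)` and `(3, 2)`, then `schurMat f` has rank at most two. -/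
theorem det_submatrix_schurMat_eq_zero (f : Entry → R) (h₁ : f (2, 3) = 0) (h₂ : f (3, 2) = 0)
    (r c : Fin 3 → Fin 4) : ((schurMat f).submatrix r c).det = 0 := by
  have h : schurMat f = !![1, 0; 0, 1; f (2, 0), f (2, 1); f (3, 0), f (3, 1)] *
      !![f (0, 0), f (0, 1), f (0, 0) * f (0, 2) + f (0, 1) * f (1, 2),
          f (0, 0) * f (0, 3) + f (0, 1) * f (1, 3);
        f (1, 0), f (1, 1), f (1, 0) * f (0, 2) + f (1, 1) * f (1, 2),
          f (1, 0) * f (0, 3) + f (1, 1) * f (1, 3)] := by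
    ext i j
    fin_cases i <;> fin_cases j <;> simp [schurMat, h₁, h₂, mul_apply, Fin.sum_univ_two]
  rw [h, det_fin_three]
  simp only [submatrix_apply, mul_apply, Fin.sum_univ_two]
  ring

/-- A matrix with invertible leading `2`-minor in which the principal `3`-minors containing it
vanish is of the form `schurMat f`. -/
theorem exists_schurMat_eq (M : Matrix (Fin 4) (Fin 4) R)
    (hu : IsUnit (M 0 0 * M 1 1 - M 0 1 * M 1 0)) (h2 : minorThree M 0 1 3 = 0)
    (h3 : minorThree M 0 1 2 = 0) :
    ∃ f : Entry → R, schurMat f = M ∧ leadMinor f = M 0 0 * M 1 1 - M 0 1 * M 1 0 := by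
  obtain ⟨y, hy⟩ := hu.exists_right_inv
  rw [minorThree_eq] at h2 h3
  refine ⟨fun ij => (!![M 0 0, M 0 1, y * (M 1 1 * M 0 2 - M 0 1 * M 1 2),
      y * (M 1 1 * M 0 3 - M 0 1 * M 1 3);
    M 1 0, M 1 1, y * (M 0 0 * M 1 2 - M 1 0 * M 0 2), y * (M 0 0 * M 1 3 - M 1 0 * M 0 3);
    y * (M 2 0 * M 1 1 - M 2 1 * M 1 0), y * (M 2 1 * M 0 0 - M 2 0 * M 0 1), 0,
      y * (M 2 3 - y * (M 2 0 * M 1 1 - M 2 1 * M 1 0) * M 0 3 -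
        y * (M 2 1 * M 0 0 - M 2 0 * M 0 1) * M 1 3);
    y * (M 3 0 * M 1 1 - M 3 1 * M 1 0), y * (M 3 1 * M 0 0 - M 3 0 * M 0 1),
      y * (M 3 2 - y * (M 3 0 * M 1 1 - M 3 1 * M 1 0) * M 0 2 -
        y * (M 3 1 * M 0 0 - M 3 0 * M 0 1) * M 1 2), 0]
      : Matrix (Fin 4) (Fin 4) R) ij.1 ij.2, ?_, by simp [leadMinor]⟩
  ext i j
  fin_cases i <;> fin_cases j <;> simp [schurMat, leadMinor]
  · linear_combination M 0 2 * hy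
  · linear_combination M 0 3 * hy
  · linear_combination M 1 2 * hy
  · linear_combination M 1 3 * hy
  · linear_combination M 2 0 * hy
  · linear_combination M 2 1 * hy
  · linear_combination ((M 2 0 * M 1 1 - M 2 1 * M 1 0) * M 0 2 +
      (M 2 1 * M 0 0 - M 2 0 * M 0 1) * M 1 2) * y * hy - y * h3 + M 2 2 * hy
  · linear_combination M 2 3 * hy
  · linear_combination M 3 0 * hy
  · linear_combination M 3 1 * hy
  · linear_combination M 3 2 * hy
  · linear_combination ((M 3 0 * M 1 1 - M 3 1 * M 1 0) * M 0 3 +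
      (M 3 1 * M 0 0 - M 3 0 * M 0 1) * M 1 3) * y * hy - y * h2 + M 3 3 * hy

end Schur

section Main

open MvPolynomial

variable (K : Type*) [Field K]

theorem toPoly_sparseMinorThree (a b c : Fin 4) :
    (sparseMinorThree a b c).toPoly K = minorThree (genMat K 4) a b c := by
  rw [minorThree_eq]
  simp [sparseMinorThree, monomial_exponent, genMat]
  ring

theorem toPoly_sparseMinorTwo :
    sparseMinorTwo.toPoly K = leadMinor (X : Entry → MvPolynomial Entry K) := by
  simp [sparseMinorTwo, monomial_exponent, leadMinor]
  ring

theorem det_submatrix_coe_eq {R : Type*} [CommRing R] (M : Matrix (Fin 4) (Fin 4) R)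
    (s : Finset (Fin 4)) (g : Fin 3 → Fin 4) (hg : Function.Injective g)
    (hs : ∀ i, i ∈ s ↔ i ∈ Set.range g) :
    (M.submatrix (fun i : {x // x ∈ s} => (i : Fin 4)) (fun j : {x // x ∈ s} => (j : Fin 4))).det =
      (M.submatrix g g).det := by
  let e : Fin 3 ≃ {x // x ∈ s} := (Equiv.ofInjective g hg).trans
    (Equiv.subtypeEquivRight fun i => (hs i).symm)
  rw [← det_submatrix_equiv_self e]
  rfl

theorem prinMinorIdeal_four_three : prinMinorIdeal K 4 3 = Ideal.span
    {minorThree (genMat K 4) 1 2 3, minorThree (genMat K 4) 0 2 3,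
      minorThree (genMat K 4) 0 1 3, minorThree (genMat K 4) 0 1 2} := by
  have key (s : Finset (Fin 4)) (a b c : Fin 4) (hs : s = {a, b, c})
      (hg : Function.Injective ![a, b, c]) :
      ((genMat K 4).submatrix (fun i : {x // x ∈ s} => (i : Fin 4))
        (fun j : {x // x ∈ s} => (j : Fin 4))).det = minorThree (genMat K 4) a b c := by
    refine det_submatrix_coe_eq _ s ![a, b, c] hg fun i => ?_
    simp [hs, eq_comm, or_comm, or_left_comm]
  refine le_antisymm (Ideal.span_le.2 ?_) (Ideal.span_mono ?_)
  · rintro _ ⟨s, hs, rfl⟩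
    have : ∀ s : Finset (Fin 4), s.card = 3 →
        s = {1, 2, 3} ∨ s = {0, 2, 3} ∨ s = {0, 1, 3} ∨ s = {0, 1, 2} := by decide
    refine Ideal.subset_span ?_
    rcases this s hs with h | h | h | h
    · rw [key s _ _ _ h (by decide)]; simp
    · rw [key s _ _ _ h (by decide)]; simp
    · rw [key s _ _ _ h (by decide)]; simp
    · rw [key s _ _ _ h (by decide)]; simp
  · rintro _ (rfl | rfl | rfl | rfl)
    · exact ⟨_, by decide, (key _ _ _ _ rfl (by decide)).symm⟩
    · exact ⟨_, by decide, (key _ _ _ _ rfl (by decide)).symm⟩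
    · exact ⟨_, by decide, (key _ _ _ _ rfl (by decide)).symm⟩
    · exact ⟨_, by decide, (key _ _ _ _ rfl (by decide)).symm⟩

/-- The leading principal `2`-minor is a nonzerodivisor modulo the principal `3`-minors. -/
theorem regularMod_leadMinor :
    RegularMod (prinMinorIdeal K 4 3) (leadMinor (X : Entry → MvPolynomial Entry K)) := by
  have h := minorsCert.weakRegular (K := K) _ minorsCert_check
  simp only [List.map_cons, List.map_nil, toPoly_sparseMinorThree, toPoly_sparseMinorTwo] at h
  have h1 := h.1.adjoinList h.2
  simp only [adjoinList, bot_sup_eq] at h1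
  rw [prinMinorIdeal_four_three]
  simpa only [Ideal.span_insert, sup_assoc] using h1

theorem prinMinorIdeal_le_detIdeal (n t : ℕ) : prinMinorIdeal K n t ≤ detIdeal K n t := by
  refine Ideal.span_mono ?_
  rintro _ ⟨s, hs, rfl⟩
  refine ⟨s, s, hs, hs, ?_⟩
  rw [← det_submatrix_equiv_self (s.orderIsoOfFin hs).toEquiv]
  rfl

/-- The parametrization `X ↦ schurMat X`. -/
noncomputable def schurHom : MvPolynomial Entry K →ₐ[K] MvPolynomial Entry K :=
  aeval fun ij => schurMat X ij.1 ij.2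

theorem genMat_map_schurHom :
    (genMat K 4).map (schurHom K : MvPolynomial Entry K →+* MvPolynomial Entry K) =
      schurMat X := by
  ext1 i j
  simp [genMat, schurHom]

/-- The ideal of the reduced principal minors. -/
noncomputable def reducedIdeal : Ideal (MvPolynomial Entry K) :=
  Ideal.span {reducedMinorZero X, reducedMinorOne X}

theorem schurHom_mem_reducedIdeal {f : MvPolynomial Entry K} (hf : f ∈ prinMinorIdeal K 4 3) :
    schurHom K f ∈ reducedIdeal K := by
  rw [prinMinorIdeal_four_three] at hf
  refine Ideal.span_le (I := (reducedIdeal K).comap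
    (schurHom K : MvPolynomial Entry K →+* MvPolynomial Entry K)) |>.2 ?_ hf
  rintro _ (rfl | rfl | rfl | rfl) <;>
    rw [SetLike.mem_coe, Ideal.mem_comap, map_minorThree, genMat_map_schurHom]
  · rw [minorThree_schurMat_one_two_three]
    exact neg_mem (Ideal.mul_mem_left _ _ (Ideal.subset_span (by simp)))
  · rw [minorThree_schurMat_zero_two_three]
    exact neg_mem (Ideal.mul_mem_left _ _ (Ideal.subset_span (by simp)))
  · rw [minorThree_schurMat_zero_one_three]
    exact zero_mem _
  · rw [minorThree_schurMat_zero_one_two]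
    exact zero_mem _

theorem schurHom_mem_span_pair {f : MvPolynomial Entry K} (hf : f ∈ detIdeal K 4 3) :
    schurHom K f ∈ Ideal.span {(X (2, 3) : MvPolynomial Entry K), X (3, 2)} := by
  refine Ideal.span_le (I := (Ideal.span {(X (2, 3) : MvPolynomial Entry K), X (3, 2)}).comap
    (schurHom K : MvPolynomial Entry K →+* MvPolynomial Entry K)) |>.2 ?_ hf
  rintro _ ⟨I, J, hI, hJ, rfl⟩
  rw [SetLike.mem_coe, Ideal.mem_comap]
  set 𝔞 := Ideal.span {(X (2, 3) : MvPolynomial Entry K), X (3, 2)}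
  have h := det_submatrix_schurMat_eq_zero (Ideal.Quotient.mk 𝔞 ∘ X)
    (Ideal.Quotient.eq_zero_iff_mem.2 (Ideal.subset_span (by simp)))
    (Ideal.Quotient.eq_zero_iff_mem.2 (Ideal.subset_span (by simp)))
    (fun a => I.orderIsoOfFin hI a) (fun a => J.orderIsoOfFin hJ a)
  rw [← schurMat_map, ← genMat_map_schurHom] at h
  rw [← Ideal.Quotient.eq_zero_iff_mem, ← h, RingHom.map_det, RingHom.map_det]
  rfl

theorem weakRegular_of_check {F : List (SparsePoly Entry)} (c : RegularityCert Entry)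
    (h : c.check F = true) {l : List (MvPolynomial Entry K)}
    (hl : F.map (fun f => f.toPoly K) = l) : WeakRegular ⊥ l :=
  hl ▸ c.weakRegular F h

theorem regularMod_reducedIdeal_leadMinor :
    RegularMod (reducedIdeal K) (leadMinor (X : Entry → MvPolynomial Entry K)) := by
  have h : WeakRegular ⊥ [(leadMinor X : MvPolynomial Entry K), reducedMinorZero X,
      reducedMinorOne X] := by
    refine weakRegular_of_check K (F := [sparseMinorTwo,
      [(1, [(1, 1), (2, 3), (3, 2)]), (1, [(3, 0), (0, 2), (2, 3)]), (1, [(2, 0), (0, 3), (3, 2)])],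
      [(1, [(0, 0), (2, 3), (3, 2)]), (1, [(3, 1), (1, 2), (2, 3)]),
        (1, [(2, 1), (1, 3), (3, 2)])]])
      (.weight [(3, 0), (0, 2), (2, 1), (1, 3)] (.weight [(0, 0)] .leaf))
      (by decide +kernel) ?_
    rw [List.map_cons, toPoly_sparseMinorTwo]
    simp [monomial_exponent, reducedMinorZero, reducedMinorOne, mul_assoc, add_assoc]
  have h1 := h.1.adjoinList h.2
  simp only [adjoinList, bot_sup_eq] at h1
  rwa [reducedIdeal, Ideal.span_insert]

theorem mem_reducedIdeal_of_mul_mem {F : MvPolynomial Entry K}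
    (hF : F ∈ Ideal.span {(X (2, 3) : MvPolynomial Entry K), X (3, 2)})
    (h : X (2, 3) * X (3, 2) * F ∈ reducedIdeal K) : F ∈ reducedIdeal K := by
  have e0 : reducedMinorZero (X : Entry → MvPolynomial Entry K) =
    X (1, 1) * X (2, 3) * X (3, 2) + X (3, 0) * X (0, 2) * X (2, 3) +
      X (2, 0) * X (0, 3) * X (3, 2) := rfl
  have e1 : reducedMinorOne (X : Entry → MvPolynomial Entry K) =
    X (0, 0) * X (2, 3) * X (3, 2) + X (3, 1) * X (1, 2) * X (2, 3) +
      X (2, 1) * X (1, 3) * X (3, 2) := rfl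
  rw [reducedIdeal, e0, e1] at h ⊢
  refine mem_span_pair_of_mul_mem ?_ ?_ ?_ hF h
  · refine weakRegular_of_check K (F := [[(1, [(2, 3)])], [(1, [(3, 2)])],
      [(1, [(3, 0), (0, 2), (2, 1), (1, 3)]), (-1, [(2, 0), (0, 3), (3, 1), (1, 2)])]])
      (.weight [(3, 0)] .leaf) (by decide +kernel) ?_
    simp [monomial_exponent, mul_assoc, sub_eq_add_neg]
  · refine weakRegular_of_check K (F := [[(1, [(2, 3)])], [(1, [(2, 1), (1, 3)])],
      [(1, [(2, 0), (0, 3)])]]) .leaf (by decide +kernel) ?_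
    simp [monomial_exponent]
  · refine weakRegular_of_check K (F := [[(1, [(3, 2)])], [(1, [(3, 1), (1, 2)])],
      [(1, [(3, 0), (0, 2)])]]) .leaf (by decide +kernel) ?_
    simp [monomial_exponent]

theorem mem_reducedIdeal_of_pow_mul_mem (n : ℕ) {F : MvPolynomial Entry K}
    (hF : F ∈ Ideal.span {(X (2, 3) : MvPolynomial Entry K), X (3, 2)})
    (h : (schurMat X).det ^ n * F ∈ reducedIdeal K) : F ∈ reducedIdeal K := by
  induction n generalizing F with
  | zero => simpa using h
  | succ n ih =>
    have h1 : (schurMat X).det * F ∈ reducedIdeal K :=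
      ih (Ideal.mul_mem_left _ _ hF) (by rwa [← mul_assoc, ← pow_succ])
    rw [det_schurMat, neg_mul, neg_mem_iff, mul_assoc] at h1
    exact mem_reducedIdeal_of_mul_mem K hF ((regularMod_reducedIdeal_leadMinor K).pow 3 _ h1)

/-- A polynomial whose image under the parametrization lies in the ideal of the reduced minors
lies in the ideal of the principal minors. -/
theorem mem_prinMinorIdeal_of_schurHom_mem {f : MvPolynomial Entry K}
    (hf : schurHom K f ∈ reducedIdeal K) : f ∈ prinMinorIdeal K 4 3 := by
  have hP := prinMinorIdeal_four_three K
  set P := prinMinorIdeal K 4 3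
  set d : MvPolynomial Entry K := leadMinor X with hd
  let A := Localization.Away (Ideal.Quotient.mk P d)
  let φ : MvPolynomial Entry K →ₐ[K] A :=
    (IsScalarTower.toAlgHom K (MvPolynomial Entry K ⧸ P) A).comp (Ideal.Quotient.mkₐ K P)
  have hφ (x) : φ x = algebraMap _ A (Ideal.Quotient.mk P x) := rfl
  let M : Matrix (Fin 4) (Fin 4) A := (genMat K 4).map (φ : MvPolynomial Entry K →+* A)
  have hM (a b c : Fin 4) (h : minorThree (genMat K 4) a b c ∈ P) : minorThree M a b c = 0 := by
    rw [← map_minorThree]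
    exact (congrArg (algebraMap _ A) (Ideal.Quotient.eq_zero_iff_mem.2 h)).trans (map_zero _)
  have hMu : IsUnit (M 0 0 * M 1 1 - M 0 1 * M 1 0) := by
    have : M 0 0 * M 1 1 - M 0 1 * M 1 0 = φ d := by simp [M, hd, leadMinor, genMat]
    rw [this, hφ]
    exact IsLocalization.Away.algebraMap_isUnit _
  obtain ⟨g, hg, hgd⟩ := exists_schurMat_eq M hMu
    (hM 0 1 3 (hP ▸ Ideal.subset_span (by simp))) (hM 0 1 2 (hP ▸ Ideal.subset_span (by simp)))
  rw [← hgd] at hMu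
  have h0 : reducedMinorZero g = 0 := by
    have := hM 1 2 3 (hP ▸ Ideal.subset_span (by simp))
    rwa [← hg, minorThree_schurMat_one_two_three, neg_eq_zero, (hMu.pow 2).mul_right_eq_zero]
      at this
  have h1 : reducedMinorOne g = 0 := by
    have := hM 0 2 3 (hP ▸ Ideal.subset_span (by simp))
    rwa [← hg, minorThree_schurMat_zero_two_three, neg_eq_zero, (hMu.pow 2).mul_right_eq_zero]
      at this
  have hη : (aeval g).comp (schurHom K) = φ := by
    refine algHom_ext fun ij => ?_
    have h2 := schurMat_map
      ((aeval g : MvPolynomial Entry K →ₐ[K] A) : MvPolynomial Entry K →+* A) X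
    have h3 : ((aeval g : MvPolynomial Entry K →ₐ[K] A) : MvPolynomial Entry K →+* A) ∘ X = g := by
      ext; simp
    rw [h3, hg] at h2
    simpa [schurHom, M, genMat] using congrFun₂ h2 ij.1 ij.2
  have hφf : φ f = 0 := by
    rw [← hη, AlgHom.comp_apply]
    refine Ideal.span_le (I := RingHom.ker (aeval g : MvPolynomial Entry K →ₐ[K] A)) |>.2 ?_ hf
    rintro _ (rfl | rfl)
    · simpa [reducedMinorZero, RingHom.mem_ker] using h0
    · simpa [reducedMinorOne, RingHom.mem_ker] using h1
  rw [hφ, IsLocalization.map_eq_zero_iff (Submonoid.powers (Ideal.Quotient.mk P d))] at hφf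
  obtain ⟨⟨_, n, rfl⟩, hm⟩ := hφf
  refine (regularMod_leadMinor K).pow n f ?_
  rw [← Ideal.Quotient.eq_zero_iff_mem]
  simpa using hm

end Main

/-- For `n = 4`, the ideal `P₃` generated by the principal 3-minors of the generic
`4 × 4` matrix equals the intersection `I₃ ⊓ Q₃` of the determinantal ideal with the
contracted ideal. -/
theorem prinMinorIdeal_three_eq_inf (K : Type*) [Field K] [IsAlgClosed K] :
    prinMinorIdeal K 4 3 = detIdeal K 4 3 ⊓ Qideal K 4 := by
  refine le_antisymm (le_inf (prinMinorIdeal_le_detIdeal K 4 3) Ideal.le_comap_map) ?_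
  rintro f ⟨hI, hQ⟩
  obtain ⟨_, ⟨n, rfl⟩, hn⟩ := (IsLocalization.algebraMap_mem_map_algebraMap_iff
    (Submonoid.powers (genMat K 4).det) _ _ _).1 (Ideal.mem_comap.1 hQ)
  refine mem_prinMinorIdeal_of_schurHom_mem K
    (mem_reducedIdeal_of_pow_mul_mem K n (schurHom_mem_span_pair K hI) ?_)
  have := schurHom_mem_reducedIdeal K hn
  have hdet : schurHom K (genMat K 4).det = (schurMat MvPolynomial.X).det := by
    rw [← genMat_map_schurHom]
    exact RingHom.map_det (schurHom K : MvPolynomial Entry K →+* MvPolynomial Entry K) _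
  rwa [map_mul, map_pow, hdet] at this
end
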